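/- Let q be a power of 2, let n ≥ 1, and let V be a non-degenerate quadratic space of dimension 2n+1 over 𝐅_q. Then the number of orbits of O(V) acting by conjugation on the set of nilpotent elements of 𝔬(V) equals p₂(n), the number of ordered pairs (α,β) of partitions with |α|+|β| = n. -/

import Mathlib

open Module Finset

/-- The radical `V^⊥ = {v | ⟨v,w⟩ = 0 for all w}` of the polar form of `Q`. -/
def QuadraticForm.polarRadical {F V : Type*} [Field F] [AddCommGroup V] [Module F V]
    (Q : QuadraticForm F V) : Submodule F V :=
  LinearMap.ker (QuadraticMap.polarBilin Q)

/-- A quadratic space `(V, Q)` (in characteristic 2) is non-degenerate if `V ≠ 0`,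
`dim V^⊥ ≤ 1` and `Q(v) ≠ 0` for every nonzero `v ∈ V^⊥`. -/
def QuadraticForm.IsNondegenerateFormSpace {F V : Type*} [Field F] [AddCommGroup V] [Module F V]
    (Q : QuadraticForm F V) : Prop :=
  Nontrivial V ∧ Module.finrank F Q.polarRadical ≤ 1 ∧
    ∀ v ∈ Q.polarRadical, v ≠ 0 → Q v ≠ 0

/-- Membership in the orthogonal Lie algebra
`𝔬(V) = {x ∈ End(V) | ⟨xv, v⟩ = 0 ∀ v, tr x = 0}`. -/
def QuadraticForm.mem_oLie {F V : Type*} [Field F] [AddCommGroup V] [Module F V]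
    (Q : QuadraticForm F V) (x : Module.End F V) : Prop :=
  (∀ v : V, QuadraticMap.polar Q (x v) v = 0) ∧ LinearMap.trace F V x = 0

/-- Two endomorphisms of `V` are conjugate under the orthogonal group
`O(V) = {g ∈ GL(V) | Q(gv) = Q(v) ∀ v}`. -/
def QuadraticForm.OConj {F V : Type*} [Field F] [AddCommGroup V] [Module F V]
    (Q : QuadraticForm F V) (x y : Module.End F V) : Prop :=
  ∃ g : V ≃ₗ[F] V, (∀ v : V, Q (g v) = Q v) ∧
    y = g.toLinearMap ∘ₗ x ∘ₗ g.symm.toLinearMap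

/-- The number of orbits of `O(V)` acting by conjugation on the set of nilpotent
elements of `𝔬(V)`. -/
noncomputable def QuadraticForm.numNilpotentOOrbits {F V : Type*} [Field F] [AddCommGroup V]
    [Module F V] (Q : QuadraticForm F V) : ℕ :=
  Nat.card (Quot fun x y : {x : Module.End F V // Q.mem_oLie x ∧ IsNilpotent x} =>
    Q.OConj x.1 y.1)

/-- `p(k)`, the number of partitions of `k`. -/
def numPartitions (k : ℕ) : ℕ := Fintype.card (Nat.Partition k)

/-- `p₂(n)`, the number of ordered pairs `(α, β)` of partitions with `|α| + |β| = n`. -/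
def numPartitionPairs (n : ℕ) : ℕ :=
  ∑ k ∈ Finset.range (n + 1), numPartitions k * numPartitions (n - k)


abbrev BP (n : ℕ) : Type :=
  {p : (Fin n → ℕ) × (Fin n → ℕ) // Antitone p.1 ∧ Antitone p.2 ∧ ∑ i, p.1 i + ∑ i, p.2 i = n}

abbrev AP (n k : ℕ) : Type := {f : Fin n → ℕ // Antitone f ∧ ∑ i, f i = k}


def apToPartition (n k : ℕ) (f : AP n k) : Nat.Partition k :=
  Nat.Partition.ofSums k (Multiset.ofList (List.ofFn f.1)) (by
    rw [Multiset.sum_coe, List.sum_ofFn]; exact f.2.2)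

theorem apToPartition_bij (n k : ℕ) (hk : k ≤ n) : Function.Bijective (apToPartition n k) := by
  constructor
  · intro f g h
    have h1 := congrArg Nat.Partition.parts h
    simp only [apToPartition, Nat.Partition.ofSums] at h1
    have h2 : Multiset.ofList (List.ofFn f.1) = Multiset.ofList (List.ofFn g.1) := by
      have hc : ∀ f : AP n k, Multiset.ofList (List.ofFn f.1) =
          Multiset.filter (· ≠ 0) (Multiset.ofList (List.ofFn f.1)) +
          Multiset.replicate (n - (Multiset.filter (· ≠ 0) (Multiset.ofList (List.ofFn f.1))).card) 0 := by
        intro f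
        have e1 := Multiset.filter_add_not (· ≠ 0) (Multiset.ofList (List.ofFn f.1))
        have e2 : Multiset.filter (fun a => ¬ (a ≠ 0)) (Multiset.ofList (List.ofFn f.1)) =
          Multiset.replicate (Multiset.filter (fun a => ¬ (a ≠ 0)) (Multiset.ofList (List.ofFn f.1))).card 0 := by
          rw [Multiset.eq_replicate]
          refine ⟨rfl, fun b hb => ?_⟩
          have := (Multiset.mem_filter.1 hb).2
          simpa using this
        have e3 := congrArg Multiset.card e1
        rw [Multiset.card_add, Multiset.coe_card, List.length_ofFn] at e3
        conv_lhs => rw [← e1, e2]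
        congr 2
        omega
      rw [hc f, hc g, h1]
    have h3 : List.ofFn f.1 = List.ofFn g.1 := by
      refine List.Perm.eq_of_pairwise (le := (· ≥ ·)) ?_ ?_ ?_ (Multiset.coe_eq_coe.1 h2)
      · intro a b _ _ h1 h2; exact le_antisymm h2 h1
      · exact (List.sortedGE_ofFn_iff.2 f.2.1).pairwise
      · exact (List.sortedGE_ofFn_iff.2 g.2.1).pairwise
    exact Subtype.ext (List.ofFn_injective h3)
  · intro p
    have hlen : p.parts.card ≤ n := by
      refine le_trans ?_ hk
      have h := p.parts_sum
      have : p.parts.card • 1 ≤ p.parts.sum :=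
        Multiset.card_nsmul_le_sum (fun x hx => p.parts_pos hx)
      simpa [h] using this
    set l := p.parts.sort (· ≥ ·) ++ List.replicate (n - p.parts.card) 0 with hl
    have hll : l.length = n := by simp [hl]; omega
    have hs : l.Pairwise (· ≥ ·) := by
      rw [hl, List.pairwise_append]
      refine ⟨Multiset.pairwise_sort _ _, ?_, ?_⟩
      · rw [List.pairwise_replicate]; right; exact le_refl _
      · intro a _ b hb
        rw [List.mem_replicate] at hb
        rw [hb.2]; exact Nat.zero_le _
    have hof : List.ofFn (fun i : Fin n => l.get (i.cast hll.symm)) = l := by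
      apply List.ext_get
      · simp [hll]
      · intro i h1 h2; simp
    refine ⟨⟨fun i => l.get (i.cast hll.symm), ?_, ?_⟩, ?_⟩
    · rw [← List.sortedGE_ofFn_iff, hof]; exact hs.sortedGE
    · rw [← List.sum_ofFn, hof, hl, List.sum_append]
      have : (p.parts.sort (· ≥ ·)).sum = k := by
        rw [← Multiset.sum_coe, Multiset.sort_eq, p.parts_sum]
      simp [this]
    · apply Nat.Partition.ext
      simp only [apToPartition, Nat.Partition.ofSums, hof]
      rw [hl, ← Multiset.coe_add, Multiset.sort_eq, Multiset.filter_add]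
      have e1 : Multiset.filter (· ≠ 0) p.parts = p.parts := by
        rw [Multiset.filter_eq_self]; intro a ha; exact (p.parts_pos ha).ne'
      have e2 : Multiset.filter (· ≠ 0) (Multiset.ofList (List.replicate (n - p.parts.card) 0)) = 0 := by
        rw [Multiset.filter_eq_nil]; intro a ha
        have := List.eq_of_mem_replicate (Multiset.mem_coe.1 ha)
        simp [this]
      rw [e1, e2, add_zero]

theorem card_AP (n k : ℕ) (hk : k ≤ n) : Nat.card (AP n k) = numPartitions k := by
  rw [numPartitions, Nat.card_eq_of_bijective _ (apToPartition_bij n k hk), Nat.card_eq_fintype_card]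

def bpEquiv (n : ℕ) : BP n ≃ (Σ k : Fin (n + 1), AP n k × AP n (n - k)) where
  toFun p := ⟨⟨∑ i, p.1.1 i, by have := p.2.2.2; omega⟩, ⟨p.1.1, p.2.1, rfl⟩,
    ⟨p.1.2, p.2.2.1, by have := p.2.2.2; simp only; omega⟩⟩
  invFun q := ⟨(q.2.1.1, q.2.2.1), q.2.1.2.1, q.2.2.2.1, by
    have h1 := q.2.1.2.2; have h2 := q.2.2.2.2; have := q.1.2; simp only; omega⟩
  left_inv p := rfl
  right_inv q := by
    obtain ⟨⟨k, hk⟩, ⟨f, hf, hfk⟩, ⟨g, hg, hgk⟩⟩ := q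
    simp only at hfk hgk
    subst hfk
    rfl

theorem card_BP (n : ℕ) : Nat.card (BP n) = numPartitionPairs n := by
  have hfin : ∀ k : Fin (n + 1), Finite (AP n k × AP n (n - k)) := by
    intro k
    have h1 : Finite (AP n k) := Finite.of_injective _ (apToPartition_bij n k (by have := k.2; omega)).1
    have h2 : Finite (AP n (n - k)) := Finite.of_injective _ (apToPartition_bij n (n - k) (by omega)).1
    infer_instance
  rw [Nat.card_congr (bpEquiv n), Nat.card_sigma, numPartitionPairs, Finset.sum_range]
  refine Finset.sum_congr rfl fun k _ => ?_
  rw [Nat.card_prod, card_AP n k (by have := k.2; omega), card_AP n (n - k) (by omega)]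

/-- cyclic submodule `K[x] w` -/
def cyc {K W : Type*} [Field K] [AddCommGroup W] [Module K W] (x : End K W) (w : W) :
    Submodule K W := Submodule.span K (Set.range fun i : ℕ => (x ^ i) w)

section ClaimA
variable {K W : Type*} [Field K] [AddCommGroup W] [Module K W]

theorem mem_cyc (x : End K W) (w : W) (i : ℕ) : (x ^ i) w ∈ cyc x w :=
  Submodule.subset_span ⟨i, rfl⟩

theorem self_mem_cyc (x : End K W) (w : W) : w ∈ cyc x w := mem_cyc x w 0

theorem cyc_le {x : End K W} {w : W} {S : Submodule K W} (h : ∀ i, (x ^ i) w ∈ S) :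
    cyc x w ≤ S := by
  rw [cyc, Submodule.span_le]; rintro _ ⟨i, rfl⟩; exact h i

theorem cyc_stable (x : End K W) (w : W) : ∀ u ∈ cyc x w, x u ∈ cyc x w := by
  have : cyc x w ≤ (cyc x w).comap x := cyc_le fun i => by
    rw [Submodule.mem_comap, ← Module.End.mul_apply, ← pow_succ']; exact mem_cyc _ _ _
  exact this

theorem pow_stable {x : End K W} {S : Submodule K W} (h : ∀ u ∈ S, x u ∈ S) (i : ℕ) :
    ∀ u ∈ S, (x ^ i) u ∈ S := by
  induction i with
  | zero => intro u hu; simpa using hu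
  | succ i ih => intro u hu; rw [pow_succ', Module.End.mul_apply]; exact h _ (ih u hu)

theorem cyc_ker [FiniteDimensional K W] (x : End K W) (w : W) (z₁ z₂ : W) (h₁ : z₁ ∈ cyc x w)
    (h₂ : z₂ ∈ cyc x w) (k₁ : x z₁ = 0) (k₂ : x z₂ = 0) (hz : z₁ ≠ 0) : ∃ c : K, z₂ = c • z₁ := by
  let C := cyc x w
  let y : C →ₗ[K] C := x.restrict (cyc_stable x w)
  have hrank : finrank K (LinearMap.ker y) ≤ 1 := by
    have h := LinearMap.finrank_range_add_finrank_ker y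
    have hC : (⊤ : Submodule K C) ≤ (K ∙ (⟨w, self_mem_cyc x w⟩ : C)) ⊔ LinearMap.range y := by
      have : C ≤ ((K ∙ (⟨w, self_mem_cyc x w⟩ : C)) ⊔ LinearMap.range y).map C.subtype := by
        refine cyc_le fun i => ?_
        cases i with
        | zero =>
          exact ⟨⟨w, self_mem_cyc x w⟩, Submodule.mem_sup_left (Submodule.mem_span_singleton_self _), rfl⟩
        | succ i =>
          refine ⟨y ⟨(x ^ i) w, mem_cyc x w i⟩, Submodule.mem_sup_right ⟨_, rfl⟩, ?_⟩
          rw [pow_succ']; rfl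
      intro u _
      obtain ⟨u', hu', he⟩ := this u.2
      have : u' = u := Subtype.ext he
      rwa [← this]
    have h2 := Submodule.finrank_mono hC
    rw [finrank_top] at h2
    have h3 := Submodule.finrank_add_le_finrank_add_finrank (K ∙ (⟨w, self_mem_cyc x w⟩ : C)) (LinearMap.range y)
    have h4 := finrank_span_le_card (R := K) ({(⟨w, self_mem_cyc x w⟩ : C)} : Set C)
    simp only [Set.toFinset_singleton, Finset.card_singleton] at h4
    omega
  rw [finrank_le_one_iff] at hrank
  obtain ⟨s, hs⟩ := hrank
  obtain ⟨a, ha⟩ := hs ⟨⟨z₁, h₁⟩, by ext; simpa [y] using k₁⟩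
  obtain ⟨b, hb⟩ := hs ⟨⟨z₂, h₂⟩, by ext; simpa [y] using k₂⟩
  have ha' : a • (s : C).1 = z₁ := congrArg (fun t => ((t : LinearMap.ker y) : C).1) ha
  have hb' : b • (s : C).1 = z₂ := congrArg (fun t => ((t : LinearMap.ker y) : C).1) hb
  have hane : a ≠ 0 := by rintro rfl; apply hz; rw [← ha', zero_smul]
  exact ⟨b / a, by rw [← ha', ← hb', smul_smul, div_mul_cancel₀ _ hane]⟩

theorem omega_adj {ω : LinearMap.BilinForm K W} (halt : ω.IsAlt) {x : End K W}
    (hx : ∀ v, ω (x v) v = 0) (u v : W) : ω (x u) v = ω u (x v) := by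
  have h := hx (u + v)
  simp only [map_add, LinearMap.add_apply, hx, zero_add, add_zero] at h
  have h2 := LinearMap.BilinForm.IsAlt.neg_eq halt u (x v)
  linear_combination h + h2

theorem omega_adj_pow {ω : LinearMap.BilinForm K W} (halt : ω.IsAlt) {x : End K W}
    (hx : ∀ v, ω (x v) v = 0) (i : ℕ) (u v : W) : ω ((x ^ i) u) v = ω u ((x ^ i) v) := by
  induction i generalizing u v with
  | zero => rfl
  | succ i ih =>
    rw [pow_succ, Module.End.mul_apply, ih, omega_adj halt hx, ← Module.End.mul_apply, ← pow_succ', pow_succ]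

theorem omega_pow_self {ω : LinearMap.BilinForm K W} (halt : ω.IsAlt) {x : End K W}
    (hx : ∀ v, ω (x v) v = 0) (i : ℕ) (v : W) : ω ((x ^ i) v) v = 0 := by
  rcases Nat.even_or_odd' i with ⟨j, rfl | rfl⟩
  · rw [two_mul, pow_add, Module.End.mul_apply, omega_adj_pow halt hx]; exact halt _
  · rw [two_mul, add_assoc, pow_add, Module.End.mul_apply, omega_adj_pow halt hx, pow_succ',
      Module.End.mul_apply]; exact hx _

theorem cyc_isotropic {ω : LinearMap.BilinForm K W} (halt : ω.IsAlt) {x : End K W}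
    (hx : ∀ v, ω (x v) v = 0) (v : W) : ∀ a ∈ cyc x v, ∀ b ∈ cyc x v, ω a b = 0 := by
  intro a ha b hb
  have h1 : cyc x v ≤ LinearMap.ker (ω.flip b) := by
    refine cyc_le fun i => ?_
    have h2 : cyc x v ≤ LinearMap.ker (ω ((x ^ i) v)) := by
      refine cyc_le fun j => ?_
      rw [LinearMap.mem_ker, ← omega_adj_pow halt hx, ← Module.End.mul_apply, ← pow_add]
      exact omega_pow_self halt hx _ _
    exact h2 hb
  exact h1 ha

/-- nondegenerate pairing between cyclic pieces -/
theorem cyc_pairing [FiniteDimensional K W] {ω : LinearMap.BilinForm K W} (halt : ω.IsAlt) {x : End K W}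
    (hx : ∀ v, ω (x v) v = 0) (hnil : IsNilpotent x) (d : ℕ) (hd : x ^ (d + 1) = 0) (v f : W)
    (hvf : ω ((x ^ d) v) f ≠ 0) (z : W) (hz : z ∈ cyc x v) (hzf : ∀ b ∈ cyc x f, ω z b = 0) :
    z = 0 := by
  classical
  by_contra hne
  obtain ⟨N, hN⟩ := hnil
  have hex : ∃ j, (x ^ j) z = 0 := ⟨N, by rw [hN]; rfl⟩
  set j := Nat.find hex with hj
  have hj0 : (x ^ j) z = 0 := Nat.find_spec hex
  have hjpos : j ≠ 0 := by
    intro h; rw [h] at hj0; exact hne (by simpa using hj0)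
  obtain ⟨i, hi⟩ := Nat.exists_eq_succ_of_ne_zero hjpos
  have hi0 : (x ^ i) z ≠ 0 := Nat.find_min hex (by omega)
  rw [hi, Nat.succ_eq_add_one, pow_succ', Module.End.mul_apply] at hj0
  obtain ⟨c, hc⟩ := cyc_ker x v ((x ^ i) z) ((x ^ d) v) (pow_stable (cyc_stable x v) i z hz) (mem_cyc x v d)
    hj0 (by rw [← Module.End.mul_apply, ← pow_succ', hd]; rfl) hi0
  apply hvf
  rw [hc, map_smul, LinearMap.smul_apply, omega_adj_pow halt hx, hzf _ (mem_cyc x f i), smul_zero]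

end ClaimA

theorem claimA {K : Type*} [Field K] (k : ℕ) : ∀ (W : Type*) [AddCommGroup W] [Module K W]
    [FiniteDimensional K W] (_ : finrank K W ≤ k) (ω : LinearMap.BilinForm K W) (_ : ω.IsAlt)
    (_ : ∀ u, (∀ v, ω u v = 0) → u = 0) (x : End K W) (_ : ∀ v, ω (x v) v = 0)
    (_ : IsNilpotent x) (w : W),
    ∃ M N : Submodule K W, M ⊔ N = ⊤ ∧ (∀ u ∈ M, x u ∈ M) ∧ (∀ u ∈ N, x u ∈ N) ∧
      (∀ a ∈ M, ∀ b ∈ M, ω a b = 0) ∧ (∀ a ∈ N, ∀ b ∈ N, ω a b = 0) ∧ w ∈ M := by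
  classical
  have trivialCase : ∀ (W : Type _) [AddCommGroup W] [Module K W] (ω : LinearMap.BilinForm K W)
    (x : End K W) (w : W), Subsingleton W → 
    ∃ M N : Submodule K W, M ⊔ N = ⊤ ∧ (∀ u ∈ M, x u ∈ M) ∧ (∀ u ∈ N, x u ∈ N) ∧
      (∀ a ∈ M, ∀ b ∈ M, ω a b = 0) ∧ (∀ a ∈ N, ∀ b ∈ N, ω a b = 0) ∧ w ∈ M := by
    intro W _ _ ω x w hs
    refine ⟨⊤, ⊤, by simp, fun _ _ => trivial, fun _ _ => trivial, ?_, ?_, trivial⟩ <;>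
    · intro a _ b _
      rw [Subsingleton.elim a 0]; simp
  induction k with
  | zero =>
    intro W _ _ _ hk ω _ _ x _ _ w
    exact trivialCase W ω x w (finrank_zero_iff (R := K).1 (by omega))
  | succ k ih =>
    intro W _ _ _ hk ω halt hnd x hx hnil w
    rcases subsingleton_or_nontrivial W with hs | hnt
    · exact trivialCase W ω x w hs
    -- nilpotency index
    have hex : ∃ j, x ^ j = 0 := hnil
    obtain ⟨d, hd⟩ : ∃ d, Nat.find hex = d + 1 := by
      refine Nat.exists_eq_succ_of_ne_zero ?_
      intro h
      have := Nat.find_spec hex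
      rw [h, pow_zero] at this
      exact one_ne_zero this
    have hd1 : x ^ (d + 1) = 0 := hd ▸ Nat.find_spec hex
    have hd0 : x ^ d ≠ 0 := Nat.find_min hex (by omega)
    have hrefl : ω.IsRefl := LinearMap.BilinForm.IsAlt.isRefl halt
    have hnd' : ω.Nondegenerate := by
      refine ⟨hnd, ?_⟩
      intro u hu
      exact hnd u fun v => hrefl _ _ (hu v)
    have hyx : ∀ u, x ((x ^ d) u) = 0 := fun u => by
      rw [← Module.End.mul_apply, ← pow_succ', hd1]; rfl
    -- choose v
    obtain ⟨v, hv, hwv⟩ : ∃ v, (x ^ d) v ≠ 0 ∧ ∀ b ∈ cyc x w, ω b v = 0 := by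
      by_contra hcon
      push Not at hcon
      have hran : ∀ u, (x ^ d) u ∈ cyc x w := by
        intro u
        rw [← LinearMap.BilinForm.orthogonal_orthogonal hnd' hrefl (cyc x w)]
        rw [LinearMap.BilinForm.mem_orthogonal_iff]
        intro n hn
        rw [LinearMap.BilinForm.mem_orthogonal_iff] at hn
        have h0 : (x ^ d) n = 0 := by
          by_contra hne
          obtain ⟨b, hb, hb'⟩ := hcon n hne
          exact hb' (hn b hb)
        change ω n ((x ^ d) u) = 0
        rw [← omega_adj_pow halt hx, h0]; simp
      obtain ⟨u, hu⟩ : ∃ u, (x ^ d) u ≠ 0 := by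
        by_contra h; push Not at h; exact hd0 (LinearMap.ext h)
      obtain ⟨f, hf⟩ : ∃ f, ω ((x ^ d) u) f ≠ 0 := by
        by_contra h; push Not at h; exact hu (hnd _ h)
      have hfne : (x ^ d) f ≠ 0 := by
        intro h; apply hf; rw [omega_adj_pow halt hx, h, map_zero]
      obtain ⟨c, hc⟩ := cyc_ker x w _ _ (hran f) (hran u) (hyx f) (hyx u) hfne
      apply hf
      rw [hc, map_smul, LinearMap.smul_apply, omega_pow_self halt hx, smul_zero]
    obtain ⟨f, hf⟩ : ∃ f, ω ((x ^ d) v) f ≠ 0 := by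
      by_contra h; push Not at h; exact hv (hnd _ h)
    have hf' : ω ((x ^ d) f) v ≠ 0 := by
      intro h; apply hf; rw [omega_adj_pow halt hx]; exact hrefl _ _ h
    set E := cyc x v with hE
    set G := cyc x f with hG
    have pE := cyc_pairing halt hx hnil d hd1 v f hf
    have pG := cyc_pairing halt hx hnil d hd1 f v hf'
    have iE := cyc_isotropic halt hx v
    have iG := cyc_isotropic halt hx f
    set H := E ⊔ G with hH
    have hHx : ∀ u ∈ H, x u ∈ H := by
      intro u hu
      obtain ⟨a, ha, b, hb, rfl⟩ := Submodule.mem_sup.1 hu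
      rw [map_add]
      exact Submodule.add_mem_sup (cyc_stable x v a ha) (cyc_stable x f b hb)
    have hHnd : (ω.restrict H).Nondegenerate := by
      have key : ∀ u : H, (∀ b : H, ω u b = 0) → u = 0 := by
        rintro ⟨u, hu⟩ h
        obtain ⟨a, ha, b, hb, rfl⟩ := Submodule.mem_sup.1 hu
        have ha0 : a = 0 := pE a ha fun c hc => by
          have := h ⟨c, Submodule.mem_sup_right hc⟩
          simpa [iG b hb c hc] using this
        have hb0 : b = 0 := pG b hb fun c hc => by
          have := h ⟨c, Submodule.mem_sup_left hc⟩
          simpa [iE a ha c hc] using this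
        ext; simp [ha0, hb0]
      exact ⟨key, fun u hu => key u fun v => hrefl _ _ (hu v)⟩
    have hcompl := LinearMap.BilinForm.isCompl_orthogonal_of_restrict_nondegenerate hrefl hHnd
    set U := ω.orthogonal H with hU
    have memU : ∀ u, u ∈ U ↔ ∀ h ∈ H, ω h u = 0 := fun u => Iff.rfl
    have hUx : ∀ u ∈ U, x u ∈ U := by
      intro u hu h hh
      change ω h (x u) = 0
      rw [← omega_adj halt hx]; exact hu _ (hHx h hh)
    have hUlt : finrank K U < finrank K W := by
      apply Submodule.finrank_lt
      intro h
      have : f ∈ U := h ▸ Submodule.mem_top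
      exact hf (this _ (Submodule.mem_sup_left (mem_cyc x v d)))
    -- restrict
    have hwd : w ∈ H ⊔ U := by rw [hcompl.sup_eq_top]; trivial
    obtain ⟨h, hh, w', hw', hsum⟩ := Submodule.mem_sup.1 hwd
    have hhE : h ∈ E := by
      obtain ⟨a, ha, b, hb, rfl⟩ := Submodule.mem_sup.1 hh
      have : b = 0 := pG b hb fun c hc => by
        have hwc : ω w c = 0 := by
          have : E ≤ LinearMap.ker (ω w) := cyc_le fun i => by
            rw [LinearMap.mem_ker, ← omega_adj_pow halt hx]
            exact hwv _ (mem_cyc x w i)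
          exact this hc
        rw [← hsum, map_add, map_add, LinearMap.add_apply, LinearMap.add_apply, iE a ha c hc,
          hrefl _ _ (hw' c (Submodule.mem_sup_left hc))] at hwc
        simpa using hwc
      rw [this, add_zero]; exact ha
    obtain ⟨M, N, hMN, hMx, hNx, hM, hN, hwM⟩ := ih U (by omega) (ω.restrict U)
      (fun u => halt _)
      (by
        intro u hu
        apply Subtype.ext
        refine hnd _ fun z => ?_
        have hz : z ∈ H ⊔ U := by rw [hcompl.sup_eq_top]; trivial
        obtain ⟨a, ha, b, hb, rfl⟩ := Submodule.mem_sup.1 hz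
        rw [map_add, hrefl _ _ (u.2 a ha), zero_add]
        exact hu ⟨b, hb⟩)
      (x.restrict hUx) (fun u => hx _)
      (by
        obtain ⟨m, hm⟩ := hnil
        refine ⟨m, ?_⟩
        rw [Module.End.pow_restrict]
        ext u; simp [hm])
      ⟨w', hw'⟩
    have cross : ∀ h ∈ H, ∀ u : U, ω h u = 0 := fun h hh u => u.2 h hh
    have cross' : ∀ h ∈ H, ∀ u : U, ω u h = 0 := fun h hh u => hrefl _ _ (u.2 h hh)
    have aux : ∀ (A : Submodule K W) (B : Submodule K U), A ≤ H → (∀ u ∈ A, x u ∈ A) →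
        (∀ u ∈ B, x.restrict hUx u ∈ B) → (∀ a ∈ A, ∀ b ∈ A, ω a b = 0) →
        (∀ a ∈ B, ∀ b ∈ B, ω.restrict U a b = 0) →
        (∀ u ∈ A ⊔ B.map U.subtype, x u ∈ A ⊔ B.map U.subtype) ∧
        (∀ a ∈ A ⊔ B.map U.subtype, ∀ b ∈ A ⊔ B.map U.subtype, ω a b = 0) := by
      intro A B hAH hA hB iA iB
      constructor
      · intro u hu
        obtain ⟨a, ha, _, ⟨b, hb, rfl⟩, rfl⟩ := Submodule.mem_sup.1 hu
        rw [map_add]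
        exact Submodule.add_mem_sup (hA a ha) ⟨_, hB b hb, rfl⟩
      · intro u hu u' hu'
        obtain ⟨a, ha, _, ⟨b, hb, rfl⟩, rfl⟩ := Submodule.mem_sup.1 hu
        obtain ⟨a', ha', _, ⟨b', hb', rfl⟩, rfl⟩ := Submodule.mem_sup.1 hu'
        have e1 := iA a ha a' ha'
        have e2 : ω b b' = 0 := iB b hb b' hb'
        simp only [map_add, LinearMap.add_apply, Submodule.subtype_apply]
        rw [e1, e2, cross a (hAH ha) b', cross' a' (hAH ha') b]; simp
    obtain ⟨s1, s2⟩ := aux E M le_sup_left (cyc_stable x v) hMx iE hM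
    obtain ⟨t1, t2⟩ := aux G N le_sup_right (cyc_stable x f) hNx iG hN
    refine ⟨E ⊔ M.map U.subtype, G ⊔ N.map U.subtype, ?_, s1, t1, s2, t2, ?_⟩
    · rw [sup_sup_sup_comm, ← Submodule.map_sup, hMN, Submodule.map_top, Submodule.range_subtype]
      exact hcompl.sup_eq_top
    · rw [← hsum]
      exact Submodule.add_mem_sup hhE ⟨_, hwM, rfl⟩
section Model

/-- The model `K[t]`-module `⨁ K[t]/t^{l i}`. -/
abbrev ModK (K : Type*) {n : ℕ} (l : Fin n → ℕ) : Type _ := ∀ i, Fin (l i) → K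

/-- The nilpotent shift on the model. -/
def sh (K : Type*) [Field K] {n : ℕ} (l : Fin n → ℕ) : End K (ModK K l) where
  toFun f := fun i s => if h : 1 ≤ s.val then f i ⟨s.val - 1, by omega⟩ else 0
  map_add' f g := by
    ext i s; by_cases h : 1 ≤ s.val <;> simp [h]
  map_smul' c f := by
    ext i s; by_cases h : 1 ≤ s.val <;> simp [h]

/-- The distinguished vector. -/
def m0 (K : Type*) [Field K] {n : ℕ} (l ν : Fin n → ℕ) : ModK K l :=
  fun i s => if s.val = ν i then 1 else 0

theorem sh_apply {K : Type*} [Field K] {n : ℕ} (l : Fin n → ℕ) (f : ModK K l) (i : Fin n) (s : Fin (l i)) :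
    sh K l f i s = if h : 1 ≤ s.val then f i ⟨s.val - 1, by omega⟩ else 0 := rfl

theorem sh_pow_apply {K : Type*} [Field K] {n : ℕ} (l : Fin n → ℕ) (k : ℕ) (f : ModK K l) (i : Fin n)
    (s : Fin (l i)) :
    (sh K l ^ k) f i s = if h : k ≤ s.val then f i ⟨s.val - k, by omega⟩ else 0 := by
  induction k generalizing s with
  | zero => simp
  | succ k ih =>
    rw [pow_succ', Module.End.mul_apply, sh_apply]
    by_cases h : 1 ≤ s.val
    · rw [dif_pos h, ih]
      by_cases h2 : k + 1 ≤ s.val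
      · rw [dif_pos h2, dif_pos (by simp only; omega)]
        congr 2; simp only; omega
      · rw [dif_neg h2, dif_neg (by simp only; omega)]
    · rw [dif_neg h, dif_neg (by omega)]

end Model

section Enhanced
variable {K M : Type*} [Field K] [AddCommGroup M] [Module K M] {n : ℕ}

def Gen (x : End K M) (e : Fin n → M) : Prop :=
  ∀ S : Submodule K M, (∀ u ∈ S, x u ∈ S) → (∀ i, e i ∈ S) → S = ⊤

theorem nakayama {x : End K M} (hx : IsNilpotent x) (S : Submodule K M) (hS : ∀ u ∈ S, x u ∈ S)
    (h : S ⊔ LinearMap.range x = ⊤) : S = ⊤ := by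
  have key : ∀ k : ℕ, ∀ u : M, ∃ s ∈ S, ∃ t, u = s + (x ^ k) t := by
    intro k
    induction k with
    | zero => intro u; exact ⟨0, S.zero_mem, u, by simp⟩
    | succ k ih =>
      intro u
      have hu : u ∈ S ⊔ LinearMap.range x := h ▸ Submodule.mem_top
      obtain ⟨a, ha, _, ⟨b, rfl⟩, rfl⟩ := Submodule.mem_sup.1 hu
      obtain ⟨s, hs, t, rfl⟩ := ih b
      refine ⟨a + x s, S.add_mem ha (hS s hs), t, ?_⟩
      rw [map_add, pow_succ', Module.End.mul_apply, add_assoc]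
  obtain ⟨k, hk⟩ := hx
  rw [Submodule.eq_top_iff']
  intro u
  obtain ⟨s, hs, t, rfl⟩ := key k u
  rw [hk]; simpa using hs

theorem Gen.replace {x : End K M} (hx : IsNilpotent x) {e e' : Fin n → M} (hg : Gen x e)
    (h : ∀ S : Submodule K M, (∀ u ∈ S, x u ∈ S) → (∀ i, e' i ∈ S) →
      ∀ i, e i ∈ S ⊔ LinearMap.range x) : Gen x e' := by
  intro S hS he
  refine nakayama hx S hS (hg _ ?_ (h S hS he))
  intro u _
  exact Submodule.mem_sup_right ⟨u, rfl⟩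

/-- The presentation map from the model. -/
def psi (x : End K M) (l : Fin n → ℕ) (e : Fin n → M) : ModK K l →ₗ[K] M where
  toFun f := ∑ i, ∑ s : Fin (l i), f i s • (x ^ s.val) (e i)
  map_add' f g := by simp [add_smul, Finset.sum_add_distrib]
  map_smul' c f := by simp [Finset.smul_sum, smul_smul]

theorem psi_apply (x : End K M) (l : Fin n → ℕ) (e : Fin n → M) (f : ModK K l) :
    psi x l e f = ∑ i, ∑ s : Fin (l i), f i s • (x ^ s.val) (e i) := rfl

theorem row_shift (x : End K M) (L : ℕ) (e : M) (h : (x ^ L) e = 0) (f : Fin L → K) :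
    ∑ s : Fin L, f s • x ((x ^ s.val) e) =
    ∑ s : Fin L, (if h : 1 ≤ s.val then f ⟨s.val - 1, by omega⟩ else 0) • (x ^ s.val) e := by
  cases L with
  | zero => simp
  | succ L =>
    rw [Fin.sum_univ_castSucc, Fin.sum_univ_succ]
    have h1 : x ((x ^ (Fin.last L).val) e) = 0 := by
      rw [← Module.End.mul_apply, ← pow_succ']; exact h
    rw [h1, smul_zero, add_zero]
    rw [dif_neg (by simp), zero_smul, zero_add]
    refine Finset.sum_congr rfl fun s _ => ?_
    rw [dif_pos (by simp)]
    have h2 : (x ^ s.succ.val) e = x ((x ^ s.val) e) := by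
      rw [Fin.val_succ, pow_succ', Module.End.mul_apply]
    rw [h2]
    rfl

theorem psi_shift (x : End K M) (l : Fin n → ℕ) (e : Fin n → M) (ha : ∀ i, (x ^ l i) (e i) = 0)
    (f : ModK K l) : x (psi x l e f) = psi x l e (sh K l f) := by
  rw [psi_apply, psi_apply, map_sum]
  refine Finset.sum_congr rfl fun i _ => ?_
  rw [map_sum]
  simp only [map_smul]
  exact row_shift x (l i) (e i) (ha i) (f i)

theorem psi_m0 (x : End K M) (l ν : Fin n → ℕ) (e : Fin n → M) (ha : ∀ i, (x ^ l i) (e i) = 0)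
    (hν : ∀ i, ν i ≤ l i) : psi x l e (m0 K l ν) = ∑ i, (x ^ ν i) (e i) := by
  rw [psi_apply]
  refine Finset.sum_congr rfl fun i _ => ?_
  rcases (hν i).lt_or_eq with h | h
  · rw [Finset.sum_eq_single (⟨ν i, h⟩ : Fin (l i))]
    · simp [m0]
    · intro b _ hb
      have : b.val ≠ ν i := fun h' => hb (Fin.ext h')
      simp [m0, this]
    · simp
  · rw [h, ha i]
    refine Finset.sum_eq_zero fun s _ => ?_
    have : s.val ≠ ν i := by have := s.2; omega
    simp [m0, this]

theorem psi_surj (x : End K M) (l : Fin n → ℕ) (e : Fin n → M) (ha : ∀ i, (x ^ l i) (e i) = 0)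
    (hg : Gen x e) : Function.Surjective (psi x l e) := by
  rw [← LinearMap.range_eq_top]
  refine hg _ ?_ ?_
  · rintro _ ⟨f, rfl⟩
    exact ⟨_, (psi_shift x l e ha f).symm⟩
  · intro i
    refine ⟨m0 K l (Function.update l i 0), ?_⟩
    rw [psi_m0 x l _ e ha]
    · rw [Finset.sum_eq_single i]
      · simp
      · intro b _ hb; rw [Function.update_of_ne hb, ha]
      · simp
    · intro j
      by_cases h : j = i
      · subst h; simp
      · rw [Function.update_of_ne h]

theorem exists_gen [FiniteDimensional K M] (hn : finrank K M = n) (x : End K M) (hx : IsNilpotent x) :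
    ∃ (e : Fin n → M) (l : Fin n → ℕ), Gen x e ∧ (∀ i, (x ^ l i) (e i) = 0) ∧
      Function.Injective (psi x l e) := by
  classical
  let P : ℕ → Prop := fun k => ∃ (e : Fin n → M) (l : Fin n → ℕ), Gen x e ∧
    (∀ i, (x ^ l i) (e i) = 0) ∧ ∑ i, l i = k
  have hP : ∃ k, P k := by
    obtain ⟨N, hN⟩ := hx
    let b := finBasisOfFinrankEq K M hn
    refine ⟨_, b, fun _ => N, ?_, ?_, rfl⟩
    · intro S _ hb
      rw [eq_top_iff, ← b.span_eq, Submodule.span_le]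
      rintro _ ⟨i, rfl⟩; exact hb i
    · intro i; rw [hN]; rfl
  obtain ⟨e, l, hg, ha, hsum⟩ := Nat.find_spec hP
  refine ⟨e, l, hg, ha, ?_⟩
  rw [injective_iff_map_eq_zero]
  intro f hf
  by_contra hne
  let A : Finset (Σ i, Fin (l i)) := Finset.univ.filter fun p => f p.1 p.2 ≠ 0
  have hA : A.Nonempty := by
    by_contra h
    rw [Finset.not_nonempty_iff_eq_empty] at h
    apply hne
    funext i s
    by_contra h'
    have : (⟨i, s⟩ : Σ i, Fin (l i)) ∈ A := by simpa [A] using h'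
    rw [h] at this; simp at this
  obtain ⟨⟨i, s⟩, his, hmin⟩ := Finset.exists_min_image A (fun p => p.2.val) hA
  have hfis : f i s ≠ 0 := by simpa [A] using his
  have hmin' : ∀ j (t : Fin (l j)), f j t ≠ 0 → s.val ≤ t.val := fun j t h =>
    hmin ⟨j, t⟩ (by simp [A, h])
  set z : M := ∑ p : (Σ i, Fin (l i)), f p.1 p.2 • (x ^ (p.2.val - s.val)) (e p.1) with hz
  have hxz : (x ^ s.val) z = 0 := by
    rw [hz, map_sum, ← hf, psi_apply, ← Finset.univ_sigma_univ, Finset.sum_sigma]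
    refine Finset.sum_congr rfl fun j _ => Finset.sum_congr rfl fun t _ => ?_
    simp only
    rw [map_smul]
    by_cases h : f j t = 0
    · simp [h]
    · rw [← Module.End.mul_apply, ← pow_add]
      congr 3
      have := hmin' j t h; omega
  have hlt : ∑ j, Function.update l i s.val j < Nat.find hP := by
    rw [← hsum]
    refine Finset.sum_lt_sum (fun j _ => ?_) ⟨i, Finset.mem_univ _, ?_⟩
    · by_cases h : j = i
      · subst h; simp
      · rw [Function.update_of_ne h]
    · simp
  refine Nat.find_min hP hlt ⟨Function.update e i z, Function.update l i s.val, ?_, ?_, rfl⟩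
  · refine hg.replace hx fun S hS he j => ?_
    have hother : ∀ j, j ≠ i → e j ∈ S := fun j hj => by
      have := he j; rwa [Function.update_of_ne hj] at this
    by_cases hj : j = i
    · subst hj
      have hzS : z ∈ S := by simpa using he j
      have hfe : f j s • e j ∈ S ⊔ LinearMap.range x := by
        have hspl := Finset.add_sum_erase Finset.univ
          (fun p : (Σ i, Fin (l i)) => f p.1 p.2 • (x ^ (p.2.val - s.val)) (e p.1))
          (Finset.mem_univ ⟨j, s⟩)
        simp only [Nat.sub_self, pow_zero, Module.End.one_apply] at hspl
        rw [← hz] at hspl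
        rw [eq_sub_of_add_eq hspl]
        refine Submodule.sub_mem _ (Submodule.mem_sup_left hzS) (Submodule.sum_mem _ ?_)
        rintro ⟨j', t⟩ hp
        have hpne := (Finset.mem_erase.1 hp).1
        simp only
        by_cases hft : f j' t = 0
        · simp [hft]
        refine Submodule.smul_mem _ _ ?_
        by_cases hj' : j' = j
        · subst hj'
          have h1 := hmin' j' t hft
          have h2 : t.val ≠ s.val := fun h => hpne (by rw [Fin.ext h])
          obtain ⟨k, hk⟩ : ∃ k, t.val - s.val = k + 1 := ⟨t.val - s.val - 1, by omega⟩
          rw [hk, pow_succ', Module.End.mul_apply]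
          exact Submodule.mem_sup_right ⟨_, rfl⟩
        · exact Submodule.mem_sup_left (pow_stable hS _ _ (hother j' hj'))
      have := Submodule.smul_mem _ (f j s)⁻¹ hfe
      rwa [smul_smul, inv_mul_cancel₀ hfis, one_smul] at this
    · exact Submodule.mem_sup_left (hother j hj)
  · intro j
    by_cases hj : j = i
    · subst hj; simpa using hxz
    · rw [Function.update_of_ne hj, Function.update_of_ne hj]; exact ha j

theorem row_normal (x : End K M) (e : M) (L : ℕ) (h : (x ^ L) e = 0) (c : Fin L → K) :
    ∃ (ν : ℕ) (e' : M), ν ≤ L ∧ (x ^ L) e' = 0 ∧ (x ^ ν) e' = ∑ s : Fin L, c s • (x ^ s.val) e ∧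
      ∃ a : K, e - a • e' ∈ LinearMap.range x := by
  classical
  by_cases hc : ∀ s, c s = 0
  · exact ⟨L, e, le_refl _, h, by simp [hc, h], 1, by simp⟩
  push Not at hc
  have hne : (Finset.univ.filter fun s => c s ≠ 0).Nonempty := by
    obtain ⟨s, hs⟩ := hc; exact ⟨s, by simp [hs]⟩
  obtain ⟨s, hs, hmin⟩ := Finset.exists_min_image _ (fun s : Fin L => s.val) hne
  have hcs : c s ≠ 0 := by simpa using hs
  have hmin' : ∀ t, c t ≠ 0 → s.val ≤ t.val := fun t ht => hmin t (by simp [ht])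
  refine ⟨s.val, ∑ t : Fin L, c t • (x ^ (t.val - s.val)) e, s.2.le, ?_, ?_, (c s)⁻¹, ?_⟩
  · rw [map_sum]
    refine Finset.sum_eq_zero fun t _ => ?_
    rw [map_smul, ← Module.End.mul_apply, ← pow_add, add_comm, pow_add, Module.End.mul_apply, h]
    simp
  · rw [map_sum]
    refine Finset.sum_congr rfl fun t _ => ?_
    rw [map_smul]
    by_cases ht : c t = 0
    · simp [ht]
    · rw [← Module.End.mul_apply, ← pow_add]
      congr 3
      have := hmin' t ht; omega
  · rw [← Finset.add_sum_erase _ _ (Finset.mem_univ s)]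
    simp only [Nat.sub_self, pow_zero, Module.End.one_apply]
    rw [smul_add, smul_smul, inv_mul_cancel₀ hcs, one_smul, sub_add_cancel_left]
    refine Submodule.neg_mem _ (Submodule.smul_mem _ _ (Submodule.sum_mem _ fun t ht => ?_))
    by_cases hct : c t = 0
    · simp [hct]
    · refine Submodule.smul_mem _ _ ?_
      have h1 := hmin' t hct
      have h2 : t.val ≠ s.val := fun h => (Finset.mem_erase.1 ht).1 (Fin.ext h)
      obtain ⟨k, hk⟩ : ∃ k, t.val - s.val = k + 1 := ⟨t.val - s.val - 1, by omega⟩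
      rw [hk, pow_succ', Module.End.mul_apply]
      exact ⟨_, rfl⟩

/-- presentation data adapted to the vector m -/
def Dat (x : End K M) (m : M) (l : Fin n → ℕ) (e : Fin n → M) (ν : Fin n → ℕ) : Prop :=
  Gen x e ∧ (∀ i, (x ^ l i) (e i) = 0) ∧ (∀ i, ν i ≤ l i) ∧ m = ∑ i, (x ^ ν i) (e i)

theorem exists_dat [FiniteDimensional K M] (hn : finrank K M = n) (x : End K M) (hx : IsNilpotent x)
    (m : M) : ∃ (l : Fin n → ℕ) (e : Fin n → M) (ν : Fin n → ℕ), Dat x m l e ν ∧ ∑ i, l i = n := by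
  obtain ⟨e, l, hg, ha, hinj⟩ := exists_gen hn x hx
  have hsurj := psi_surj x l e ha hg
  have hdim := (LinearEquiv.ofBijective (psi x l e) ⟨hinj, hsurj⟩).finrank_eq
  rw [hn, Module.finrank_pi_fintype] at hdim
  simp only [Module.finrank_fintype_fun_eq_card, Fintype.card_fin] at hdim
  obtain ⟨f, hf⟩ := hsurj m
  choose ν e' h1 h2 h3 a h4 using fun i => row_normal x (e i) (l i) (ha i) (f i)
  refine ⟨l, e', ν, ⟨?_, h2, h1, ?_⟩, hdim⟩
  · refine hg.replace hx fun S hS he i => ?_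
    have : e i = a i • e' i + (e i - a i • e' i) := by abel
    rw [this]
    exact Submodule.add_mem_sup (S.smul_mem _ (he i)) (h4 i)
  · rw [← hf, psi_apply]
    exact Finset.sum_congr rfl fun i _ => (h3 i).symm

theorem dat_move1 {x : End K M} (hx : IsNilpotent x) {m : M} {l : Fin n → ℕ} {e : Fin n → M} {ν : Fin n → ℕ}
    (hD : Dat x m l e ν) (i j : Fin n) (hl : l j ≤ l i) (hν : ν i < ν j) :
    ∃ e' ν', Dat x m l e' ν' ∧ ∑ k, ν' k < ∑ k, ν k := by
  classical
  obtain ⟨hg, ha, hb, hm⟩ := hD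
  have hij : i ≠ j := by rintro rfl; omega
  have hji := hij.symm
  refine ⟨Function.update e i (e i + (x ^ (ν j - ν i)) (e j) - e j), Function.update ν j (ν i), ⟨?_, ?_, ?_, ?_⟩, ?_⟩
  · refine hg.replace hx fun S hS he k => Submodule.mem_sup_left ?_
    have hj : e j ∈ S := by have := he j; rwa [Function.update_of_ne hji] at this
    by_cases hk : k = i
    · subst hk
      have := he k
      rw [Function.update_self] at this
      have h2 := S.add_mem (S.sub_mem this (pow_stable hS (ν j - ν k) _ hj)) hj
      convert h2 using 1; abel
    · have := he k; rwa [Function.update_of_ne hk] at this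
  · intro k
    by_cases hk : k = i
    · subst hk
      have hz : (x ^ l k) (e j) = 0 := by
        obtain ⟨c, hc⟩ := Nat.exists_eq_add_of_le' hl
        rw [hc, pow_add, Module.End.mul_apply, ha, map_zero]
      rw [Function.update_self, map_sub, map_add, ha, hz, ← Module.End.mul_apply, ← pow_add,
        add_comm (l k), pow_add, Module.End.mul_apply, hz]
      simp
    · rw [Function.update_of_ne hk]; exact ha k
  · intro k
    by_cases hk : k = j
    · subst hk; rw [Function.update_self]; have := hb k; omega
    · rw [Function.update_of_ne hk]; exact hb k
  · rw [hm, ← sub_eq_zero, ← Finset.sum_sub_distrib, Fintype.sum_eq_add i j hij]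
    · rw [Function.update_self, Function.update_of_ne hji, Function.update_of_ne hij, Function.update_self]
      rw [map_sub, map_add, ← Module.End.mul_apply (x ^ ν i) (x ^ (ν j - ν i)), ← pow_add,
        Nat.add_sub_cancel' hν.le]
      abel
    · rintro k ⟨h1, h2⟩
      rw [Function.update_of_ne h1, Function.update_of_ne h2, sub_self]
  · refine Finset.sum_lt_sum (fun k _ => ?_) ⟨j, Finset.mem_univ _, by simpa using hν⟩
    by_cases hk : k = j
    · subst hk; simpa using hν.le
    · rw [Function.update_of_ne hk]

theorem dat_move2 {x : End K M} (hx : IsNilpotent x) {m : M} {l : Fin n → ℕ} {e : Fin n → M} {ν : Fin n → ℕ}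
    (hD : Dat x m l e ν) (i j : Fin n) (hl : l j ≤ l i) (hν : l i - ν i < l j - ν j) :
    ∃ e' ν', Dat x m l e' ν' ∧ ∑ k, ν' k < ∑ k, ν k := by
  classical
  obtain ⟨hg, ha, hb, hm⟩ := hD
  have hij : i ≠ j := by rintro rfl; omega
  have hji := hij.symm
  have hbi := hb i
  have hbj := hb j
  have hlt : l i - (l j - ν j) < ν i := by omega
  have hz : ∀ k, l i ≤ k → (x ^ k) (e i) = 0 := by
    intro k hk
    obtain ⟨c, rfl⟩ := Nat.exists_eq_add_of_le' hk
    rw [pow_add, Module.End.mul_apply, ha, map_zero]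
  refine ⟨Function.update e j (e j + (x ^ (ν i - ν j)) (e i) - (x ^ (l i - l j)) (e i)),
    Function.update ν i (l i - (l j - ν j)), ⟨?_, ?_, ?_, ?_⟩, ?_⟩
  · refine hg.replace hx fun S hS he k => Submodule.mem_sup_left ?_
    have hi : e i ∈ S := by have := he i; rwa [Function.update_of_ne hij] at this
    by_cases hk : k = j
    · subst hk
      have := he k
      rw [Function.update_self] at this
      have h2 := S.add_mem (S.sub_mem this (pow_stable hS (ν i - ν k) _ hi)) (pow_stable hS (l i - l k) _ hi)
      convert h2 using 1; abel
    · have := he k; rwa [Function.update_of_ne hk] at this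
  · intro k
    by_cases hk : k = j
    · subst hk
      rw [Function.update_self, map_sub, map_add, ha, ← Module.End.mul_apply, ← Module.End.mul_apply,
        ← pow_add, ← pow_add, hz _ (by omega), hz _ (by omega)]
      simp
    · rw [Function.update_of_ne hk]; exact ha k
  · intro k
    by_cases hk : k = i
    · subst hk; rw [Function.update_self]; omega
    · rw [Function.update_of_ne hk]; exact hb k
  · rw [hm, ← sub_eq_zero, ← Finset.sum_sub_distrib, Fintype.sum_eq_add i j hij]
    · rw [Function.update_self, Function.update_of_ne hji, Function.update_of_ne hij, Function.update_self]
      rw [map_sub, map_add, ← Module.End.mul_apply (x ^ ν j), ← Module.End.mul_apply (x ^ ν j), ← pow_add,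
        ← pow_add, show ν j + (ν i - ν j) = ν i by omega, show ν j + (l i - l j) = l i - (l j - ν j) by omega]
      abel
    · rintro k ⟨h1, h2⟩
      rw [Function.update_of_ne h1, Function.update_of_ne h2, sub_self]
  · refine Finset.sum_lt_sum (fun k _ => ?_) ⟨i, Finset.mem_univ _, by simpa using hlt⟩
    by_cases hk : k = i
    · subst hk; simpa using hlt.le
    · rw [Function.update_of_ne hk]

theorem enhanced_exists [FiniteDimensional K M] (hn : finrank K M = n) (x : End K M) (hx : IsNilpotent x)
    (m : M) : ∃ (p : BP n) (φ : ModK K (fun i => p.1.1 i + p.1.2 i) ≃ₗ[K] M),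
      (∀ f, φ (sh K _ f) = x (φ f)) ∧ φ (m0 K _ p.1.2) = m := by
  classical
  obtain ⟨l, e₀, ν₀, hD₀, hl⟩ := exists_dat hn x hx m
  have hP : ∃ k, ∃ e ν, Dat x m l e ν ∧ ∑ i, ν i = k := ⟨_, e₀, ν₀, hD₀, rfl⟩
  obtain ⟨e, ν, hD, hs⟩ := Nat.find_spec hP
  have hmin : ∀ e' ν', Dat x m l e' ν' → ¬ ∑ k, ν' k < ∑ k, ν k := by
    intro e' ν' h hlt
    rw [hs] at hlt
    exact Nat.find_min hP hlt ⟨e', ν', h, rfl⟩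
  have c1 : ∀ i j, l j ≤ l i → ν j ≤ ν i := by
    intro i j h
    by_contra h'
    obtain ⟨e', ν', h1, h2⟩ := dat_move1 hx hD i j h (by omega)
    exact hmin e' ν' h1 h2
  have c2 : ∀ i j, l j ≤ l i → l j - ν j ≤ l i - ν i := by
    intro i j h
    by_contra h'
    obtain ⟨e', ν', h1, h2⟩ := dat_move2 hx hD i j h (by omega)
    exact hmin e' ν' h1 h2
  let σ := Tuple.sort (fun i => OrderDual.toDual (l i))
  have hσ : ∀ i j, i ≤ j → l (σ j) ≤ l (σ i) := fun i j h =>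
    Tuple.monotone_sort (fun i => OrderDual.toDual (l i)) h
  obtain ⟨hg, ha, hb, hm⟩ := hD
  have hsum : ∑ i, (l (σ i) - ν (σ i)) + ∑ i, ν (σ i) = n := by
    rw [← Finset.sum_add_distrib]
    refine Eq.trans ?_ hl
    rw [← Equiv.sum_comp σ l]
    refine Finset.sum_congr rfl fun i _ => ?_
    have := hb (σ i); omega
  let p : BP n := ⟨(fun i => l (σ i) - ν (σ i), fun i => ν (σ i)), fun i j h => c2 _ _ (hσ i j h),
    fun i j h => c1 _ _ (hσ i j h), hsum⟩
  have ha' : ∀ i, (x ^ (p.1.1 i + p.1.2 i)) (e (σ i)) = 0 := by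
    intro i
    have : p.1.1 i + p.1.2 i = l (σ i) := by
      have := hb (σ i); simp only [p]; omega
    rw [this]; exact ha _
  have hg' : Gen x (fun i => e (σ i)) := by
    intro S hS h
    refine hg S hS fun i => ?_
    have := h (σ.symm i)
    simpa using this
  have hsurj := psi_surj x (fun i => p.1.1 i + p.1.2 i) (fun i => e (σ i)) ha' hg'
  have hinj : Function.Injective (psi x (fun i => p.1.1 i + p.1.2 i) (fun i => e (σ i))) := by
    refine (LinearMap.injective_iff_surjective_of_finrank_eq_finrank ?_).2 hsurj
    rw [hn, Module.finrank_pi_fintype]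
    simp only [Module.finrank_fintype_fun_eq_card, Fintype.card_fin]
    rw [Finset.sum_add_distrib]; exact hsum
  refine ⟨p, LinearEquiv.ofBijective _ ⟨hinj, hsurj⟩, ?_, ?_⟩
  · intro f
    exact (psi_shift x _ _ ha' f).symm
  · refine (psi_m0 x _ _ _ ha' (fun i => Nat.le_add_left _ _)).trans ?_
    rw [hm]
    exact Equiv.sum_comp σ (fun i => (x ^ ν i) (e i))

end Enhanced

section IsoHsec
variable {K W P : Type*} [Field K] [AddCommGroup W] [Module K W] [AddCommGroup P] [Module K P]

/-- `(W, ω, x, w)` is isomorphic to the hyperbolic structure on `P × P^*` attached to `(P, y, m)`. -/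
def IsoH (ω : LinearMap.BilinForm K W) (x : End K W) (w : W) (y : End K P) (m : P) : Prop :=
  ∃ Φ : W ≃ₗ[K] P × Dual K P, (∀ u v, ω u v = (Φ u).2 (Φ v).1 - (Φ v).2 (Φ u).1) ∧
    (∀ u, Φ (x u) = (y (Φ u).1, (Φ u).2 ∘ₗ y)) ∧ Φ w = (m, 0)

theorem isoH_pow {x : End K W} {y : End K P} (Φ : W ≃ₗ[K] P × Dual K P)
    (h : ∀ u, Φ (x u) = (y (Φ u).1, (Φ u).2 ∘ₗ y)) (k : ℕ) (u : W) :
    Φ ((x ^ k) u) = ((y ^ k) (Φ u).1, (Φ u).2 ∘ₗ (y ^ k)) := by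
  induction k with
  | zero => rfl
  | succ k ih =>
    rw [pow_succ', Module.End.mul_apply, h, ih, pow_succ']
    refine Prod.ext rfl ?_
    ext v
    simp only [LinearMap.comp_apply, Module.End.mul_apply]
    rw [← Module.End.mul_apply, ← Module.End.mul_apply, ← pow_succ', ← pow_succ]

theorem isoH_of_lagrangian [FiniteDimensional K W] (ω : LinearMap.BilinForm K W) (halt : ω.IsAlt)
    (hnd : ∀ u, (∀ v, ω u v = 0) → u = 0) (x : End K W) (hx : ∀ v, ω (x v) v = 0) (w : W)
    (M N : Submodule K W) (htop : M ⊔ N = ⊤) (hMx : ∀ u ∈ M, x u ∈ M) (hNx : ∀ u ∈ N, x u ∈ N)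
    (iM : ∀ a ∈ M, ∀ b ∈ M, ω a b = 0) (iN : ∀ a ∈ N, ∀ b ∈ N, ω a b = 0) (hw : w ∈ M) :
    IsoH ω x w (x.restrict hMx) (⟨w, hw⟩ : M) := by
  have hrefl : ω.IsRefl := LinearMap.BilinForm.IsAlt.isRefl halt
  have hspl : ∀ v, ∃ a ∈ M, ∃ b ∈ N, a + b = v := fun v =>
    Submodule.mem_sup.1 (htop ▸ Submodule.mem_top)
  have hc : IsCompl M N := by
    refine ⟨?_, codisjoint_iff.2 htop⟩
    rw [Submodule.disjoint_def]
    intro u h1 h2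
    refine hnd u fun v => ?_
    obtain ⟨a, ha, b, hb, rfl⟩ := hspl v
    rw [map_add, iM u h1 a ha, iN u h2 b hb, add_zero]
  let ψ : N →ₗ[K] Dual K M := (M.subtype.dualMap ∘ₗ ω) ∘ₗ N.subtype
  let ψ' : M →ₗ[K] Dual K N := (N.subtype.dualMap ∘ₗ ω) ∘ₗ M.subtype
  have hψ : ∀ (a : N) (b : M), ψ a b = ω a b := fun _ _ => rfl
  have hψ' : ∀ (a : M) (b : N), ψ' a b = ω a b := fun _ _ => rfl
  have inj : Function.Injective ψ := by
    rw [injective_iff_map_eq_zero]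
    intro a ha
    apply Subtype.ext
    refine hnd _ fun v => ?_
    obtain ⟨c, hc, b, hb, rfl⟩ := hspl v
    rw [map_add, iN a a.2 b hb, ← hψ a ⟨c, hc⟩, ha]; simp
  have inj' : Function.Injective ψ' := by
    rw [injective_iff_map_eq_zero]
    intro a ha
    apply Subtype.ext
    refine hnd _ fun v => ?_
    obtain ⟨c, hc, b, hb, rfl⟩ := hspl v
    rw [map_add, iM a a.2 c hc, ← hψ' a ⟨b, hb⟩, ha]; simp
  have d1 := LinearMap.finrank_le_finrank_of_injective inj
  have d2 := LinearMap.finrank_le_finrank_of_injective inj'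
  rw [Subspace.dual_finrank_eq] at d1 d2
  have hdim : finrank K N = finrank K (Dual K M) := by rw [Subspace.dual_finrank_eq]; omega
  let Ψ : N ≃ₗ[K] Dual K M := LinearEquiv.ofInjectiveOfFinrankEq ψ inj hdim
  have hΨ : ∀ (a : N) (b : M), Ψ a b = ω a b := fun _ _ => rfl
  let T := Submodule.prodEquivOfIsCompl M N hc
  let Φ : W ≃ₗ[K] M × Dual K M := T.symm ≪≫ₗ (LinearEquiv.refl K M).prodCongr Ψ
  have hΦ : ∀ (a : M) (b : N), Φ ((a : W) + b) = (a, Ψ b) := by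
    intro a b
    have : T.symm ((a : W) + b) = (a, b) := by
      rw [LinearEquiv.symm_apply_eq]; rfl
    simp only [Φ, LinearEquiv.trans_apply, this]
    rfl
  refine ⟨Φ, ?_, ?_, ?_⟩
  · intro u v
    obtain ⟨a, ha, b, hb, rfl⟩ := hspl u
    obtain ⟨c, hc, d, hd, rfl⟩ := hspl v
    rw [hΦ ⟨a, ha⟩ ⟨b, hb⟩, hΦ ⟨c, hc⟩ ⟨d, hd⟩]
    simp only [hΨ, map_add, LinearMap.add_apply]
    rw [iM a ha c hc, iN b hb d hd, ← LinearMap.BilinForm.IsAlt.neg_eq halt d a]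
    ring
  · intro u
    obtain ⟨a, ha, b, hb, rfl⟩ := hspl u
    rw [map_add, hΦ ⟨a, ha⟩ ⟨b, hb⟩, hΦ ⟨x a, hMx a ha⟩ ⟨x b, hNx b hb⟩]
    refine Prod.ext rfl ?_
    ext c
    simp only [LinearMap.comp_apply, hΨ]
    exact omega_adj halt hx b c
  · have := hΦ ⟨w, hw⟩ 0
    simpa using this

theorem isoH_transport {P' : Type*} [AddCommGroup P'] [Module K P']
    {ω : LinearMap.BilinForm K W} {x : End K W} {w : W} {y : End K P} {m : P} {y' : End K P'} {m' : P'}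
    (h : IsoH ω x w y m) (φ : P' ≃ₗ[K] P) (hφ : ∀ f, φ (y' f) = y (φ f)) (hm : φ m' = m) :
    IsoH ω x w y' m' := by
  obtain ⟨Φ, h1, h2, h3⟩ := h
  have hφ' : ∀ f, φ.symm (y f) = y' (φ.symm f) := fun f => by
    rw [LinearEquiv.symm_apply_eq, hφ, LinearEquiv.apply_symm_apply]
  refine ⟨Φ ≪≫ₗ φ.symm.prodCongr φ.dualMap, ?_, ?_, ?_⟩
  · intro u v
    rw [h1]
    simp
  · intro u
    simp only [LinearEquiv.trans_apply, h2]
    refine Prod.ext ?_ ?_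
    · simp [hφ']
    · ext v; simp [hφ]
  · simp only [LinearEquiv.trans_apply, h3]
    refine Prod.ext ?_ ?_
    · simp [← hm]
    · simp

theorem isoH_conj {W' : Type*} [AddCommGroup W'] [Module K W'] {ω : LinearMap.BilinForm K W}
    {ω' : LinearMap.BilinForm K W'} {x : End K W} {x' : End K W'} {w : W} {w' : W'} {y : End K P} {m : P}
    (h : IsoH ω x w y m) (h' : IsoH ω' x' w' y m) : ∃ g : W ≃ₗ[K] W',
      (∀ u v, ω' (g u) (g v) = ω u v) ∧ (∀ u, g (x u) = x' (g u)) ∧ g w = w' := by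
  obtain ⟨Φ, h1, h2, h3⟩ := h
  obtain ⟨Φ', h1', h2', h3'⟩ := h'
  refine ⟨Φ ≪≫ₗ Φ'.symm, ?_, ?_, ?_⟩
  · intro u v; rw [h1, h1']; simp
  · intro u; apply Φ'.injective; rw [h2']; simp [h2]
  · apply Φ'.injective; simp [h3, h3']

theorem isoH_of_conj {W' : Type*} [AddCommGroup W'] [Module K W'] {ω : LinearMap.BilinForm K W}
    {ω' : LinearMap.BilinForm K W'} {x : End K W} {x' : End K W'} {w : W} {w' : W'} {y : End K P} {m : P}
    (h : IsoH ω x w y m) (g : W' ≃ₗ[K] W)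
    (h1 : ∀ u v, ω (g u) (g v) = ω' u v) (h2 : ∀ u, g (x' u) = x (g u)) (h3 : g w' = w) :
    IsoH ω' x' w' y m := by
  obtain ⟨Φ, k1, k2, k3⟩ := h
  refine ⟨g ≪≫ₗ Φ, ?_, ?_, ?_⟩
  · intro u v; rw [← h1, k1]; rfl
  · intro u; simp [h2, k2]
  · simp [h3, k3]

theorem finrank_prod_sub {U U' : Type*} [AddCommGroup U] [Module K U] [AddCommGroup U'] [Module K U']
    [FiniteDimensional K U] [FiniteDimensional K U'] (A : Submodule K U) (B : Submodule K U') :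
    finrank K (A.prod B) = finrank K A + finrank K B := by
  rw [← Module.finrank_prod]
  have h := LinearMap.finrank_range_of_inj (f := A.subtype.prodMap B.subtype) (by
    intro a b hab
    exact Prod.ext (Subtype.ext (congrArg Prod.fst hab)) (Subtype.ext (congrArg Prod.snd hab)))
  rw [LinearMap.range_prodMap, Submodule.range_subtype, Submodule.range_subtype] at h
  exact h

theorem isoH_rank [FiniteDimensional K P] {ω : LinearMap.BilinForm K W} {x : End K W} {w : W}
    {y : End K P} {m : P} (h : IsoH ω x w y m) (k : ℕ) :
    finrank K (LinearMap.range (x ^ k)) = 2 * finrank K (LinearMap.range (y ^ k)) := by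
  obtain ⟨Φ, k1, k2, k3⟩ := h
  have e1 : (LinearMap.range (x ^ k)).map Φ.toLinearMap =
      (LinearMap.range (y ^ k)).prod (LinearMap.range (y ^ k).dualMap) := by
    rw [← LinearMap.range_prodMap, ← LinearMap.range_comp]
    have : Φ.toLinearMap ∘ₗ (x ^ k) = ((y ^ k).prodMap (y ^ k).dualMap) ∘ₗ Φ.toLinearMap := by
      apply LinearMap.ext; intro u
      exact isoH_pow Φ k2 k u
    rw [this, LinearMap.range_comp, LinearEquiv.range, Submodule.map_top]
  have e2 := LinearEquiv.finrank_map_eq Φ (LinearMap.range (x ^ k))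
  rw [← e2]
  change finrank K ((LinearMap.range (x ^ k)).map Φ.toLinearMap) = _
  rw [e1, finrank_prod_sub, LinearMap.finrank_range_dualMap_eq_finrank_range, two_mul]

theorem isoH_mem {ω : LinearMap.BilinForm K W} {x : End K W} {w : W}
    {y : End K P} {m : P} (h : IsoH ω x w y m) (i j : ℕ) :
    (x ^ j) w ∈ LinearMap.range (x ^ (i + j)) ↔ (y ^ j) m ∈ LinearMap.range (y ^ (i + j)) := by
  obtain ⟨Φ, k1, k2, k3⟩ := h
  constructor
  · rintro ⟨u, hu⟩
    have := congrArg Φ hu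
    rw [isoH_pow Φ k2, isoH_pow Φ k2, k3] at this
    exact ⟨(Φ u).1, congrArg Prod.fst this⟩
  · rintro ⟨u, hu⟩
    refine ⟨Φ.symm (u, 0), ?_⟩
    apply Φ.injective
    rw [isoH_pow Φ k2, isoH_pow Φ k2, k3]
    simp [hu]

end IsoHsec

section Types
variable {K : Type*} [Field K] {n : ℕ}

theorem sh_rank (l : Fin n → ℕ) (k : ℕ) :
    finrank K (LinearMap.range (sh K l ^ k)) = ∑ i, (l i - k) := by
  let ι : ModK K (fun i => l i - k) →ₗ[K] ModK K l :=
    { toFun := fun f i s => if h : k ≤ s.val then f i ⟨s.val - k, by have := s.2; show _ < l i - k; omega⟩ else 0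
      map_add' := by intro f g; ext i s; by_cases h : k ≤ s.val <;> simp [h]
      map_smul' := by intro c f; ext i s; by_cases h : k ≤ s.val <;> simp [h] }
  have hι : Function.Injective ι := by
    intro f g h
    funext i s
    have := congrFun (congrFun h i) ⟨s.val + k, by have : s.val < l i - k := s.2; omega⟩
    simpa [ι] using this
  have hr : LinearMap.range (sh K l ^ k) = LinearMap.range ι := by
    ext u
    constructor
    · rintro ⟨f, rfl⟩
      refine ⟨fun i s => f i ⟨s.val, by have : s.val < l i - k := s.2; omega⟩, ?_⟩
      funext i s
      rw [sh_pow_apply]; rfl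
    · rintro ⟨f, rfl⟩
      refine ⟨fun i s => if h : s.val < l i - k then f i ⟨s.val, h⟩ else 0, ?_⟩
      funext i s
      rw [sh_pow_apply]
      by_cases h : k ≤ s.val
      · have h2 : s.val - k < l i - k := by have := s.2; omega
        simp [ι, h, h2]
      · simp [ι, h]
  rw [hr, LinearMap.finrank_range_of_inj hι, Module.finrank_pi_fintype]
  simp

theorem sh_mem (l μ ν : Fin n → ℕ) (hl : ∀ r, l r = μ r + ν r) (i j : ℕ) :
    (sh K l ^ j) (m0 K l ν) ∈ LinearMap.range (sh K l ^ (i + j)) ↔ ∀ r, i ≤ ν r ∨ μ r ≤ j := by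
  constructor
  · rintro ⟨f, hf⟩ r
    by_contra hcon
    push Not at hcon
    have := congrFun (congrFun hf r) ⟨ν r + j, by rw [hl]; omega⟩
    rw [sh_pow_apply, sh_pow_apply, dif_neg (by simp only; omega), dif_pos (by simp)] at this
    simp [m0] at this
  · intro h
    refine ⟨fun r s => if s.val + i = ν r then 1 else 0, ?_⟩
    funext r s
    rw [sh_pow_apply, sh_pow_apply]
    have hs := s.2
    have hlr := hl r
    rcases h r with h | h
    · by_cases h1 : i + j ≤ s.val
      · rw [dif_pos h1, dif_pos (by omega)]
        simp only [m0]
        congr 1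
        apply propext; omega
      · rw [dif_neg h1]
        by_cases h2 : j ≤ s.val
        · rw [dif_pos h2]; simp only [m0]; rw [if_neg (by omega)]
        · rw [dif_neg h2]
    · have e1 : ∀ h2 : j ≤ s.val, m0 K l ν r ⟨s.val - j, by omega⟩ = 0 := by
        intro h2; simp only [m0]; rw [if_neg (by omega)]
      have e2 : (if h : j ≤ s.val then m0 K l ν r ⟨s.val - j, by omega⟩ else 0) = 0 := by
        by_cases h2 : j ≤ s.val
        · rw [dif_pos h2, e1 h2]
        · rw [dif_neg h2]
      rw [e2]
      by_cases h1 : i + j ≤ s.val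
      · rw [dif_pos h1, if_neg (by simp only; omega)]
      · rw [dif_neg h1]

theorem antitone_eq (l l' : Fin n → ℕ) (hl : Antitone l) (hl' : Antitone l')
    (h : ∀ k, ∑ i, (l i - k) = ∑ i, (l' i - k)) : l = l' := by
  have key : ∀ (l l' : Fin n → ℕ), Antitone l → Antitone l' →
      (∀ k, ∑ i, (l i - k) = ∑ i, (l' i - k)) → ∀ i, (∀ j < i, l j = l' j) → ¬ l i < l' i := by
    intro l l' hl hl' h i hj hlt
    have := h (l i)
    refine absurd this (ne_of_lt (Finset.sum_lt_sum (fun j _ => ?_) ⟨i, Finset.mem_univ _, by omega⟩))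
    rcases lt_or_ge j i with hji | hji
    · rw [hj j hji]
    · have := hl hji; omega
  funext i
  induction i using WellFoundedLT.induction with
  | _ i ih =>
    have h1 := key l l' hl hl' h i ih
    have h2 := key l' l hl' hl (fun k => (h k).symm) i (fun j hj => (ih j hj).symm)
    omega

variable {W : Type*} [AddCommGroup W] [Module K W]

def HasType (ω : LinearMap.BilinForm K W) (x : End K W) (w : W) (p : BP n) : Prop :=
  IsoH ω x w (sh K (fun i => p.1.1 i + p.1.2 i)) (m0 K (fun i => p.1.1 i + p.1.2 i) p.1.2)

theorem hasType_unique {ω : LinearMap.BilinForm K W} {x : End K W} {w : W} {p p' : BP n}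
    (h : HasType ω x w p) (h' : HasType ω x w p') : p = p' := by
  have hl : (fun i => p.1.1 i + p.1.2 i) = (fun i => p'.1.1 i + p'.1.2 i) := by
    refine antitone_eq _ _ (fun i j hij => add_le_add (p.2.1 hij) (p.2.2.1 hij))
      (fun i j hij => add_le_add (p'.2.1 hij) (p'.2.2.1 hij)) fun k => ?_
    have e1 := isoH_rank h k
    have e2 := isoH_rank h' k
    rw [sh_rank] at e1 e2
    omega
  have hJ : ∀ i j, (∀ r, i ≤ p.1.2 r ∨ p.1.1 r ≤ j) ↔ (∀ r, i ≤ p'.1.2 r ∨ p'.1.1 r ≤ j) := by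
    intro i j
    rw [← sh_mem (K := K) _ p.1.1 p.1.2 (fun _ => rfl), ← sh_mem (K := K) _ p'.1.1 p'.1.2 (fun _ => rfl),
      ← isoH_mem h, ← isoH_mem h']
  have hl' : ∀ r, p.1.1 r + p.1.2 r = p'.1.1 r + p'.1.2 r := fun r => congrFun hl r
  have key : ∀ p p' : BP n, (∀ r, p.1.1 r + p.1.2 r = p'.1.1 r + p'.1.2 r) →
      (∀ i j, (∀ r, i ≤ p.1.2 r ∨ p.1.1 r ≤ j) ↔ (∀ r, i ≤ p'.1.2 r ∨ p'.1.1 r ≤ j)) →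
      ∀ r, ¬ p.1.2 r < p'.1.2 r := by
    intro p p' hl hJ r hlt
    have h1 := (hJ (p'.1.2 r) (p'.1.1 r)).2 (by
      intro s
      rcases le_total s r with hs | hs
      · left; exact p'.2.2.1 hs
      · right; exact p'.2.1 hs) r
    have := hl r
    omega
  have h2 : ∀ r, p.1.2 r = p'.1.2 r := fun r => by
    have a := key p p' hl' hJ r
    have b := key p' p (fun r => (hl' r).symm) (fun i j => (hJ i j).symm) r
    omega
  have h1 : ∀ r, p.1.1 r = p'.1.1 r := fun r => by
    have := h2 r; have := hl' r; omega
  exact Subtype.ext (Prod.ext (funext h1) (funext h2))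

theorem isoH_exists [FiniteDimensional K W] (ω : LinearMap.BilinForm K W) (halt : ω.IsAlt)
    (hnd : ∀ u, (∀ v, ω u v = 0) → u = 0) (x : End K W) (hx : ∀ v, ω (x v) v = 0)
    (hnil : IsNilpotent x) (w : W) : ∃ (M : Submodule K W) (y : End K M) (m : M), IsNilpotent y ∧
      finrank K W = 2 * finrank K M ∧ IsoH ω x w y m := by
  obtain ⟨M, N, a1, a2, a3, a4, a5, a6⟩ := claimA (finrank K W) W le_rfl ω halt hnd x hx hnil w
  have h := isoH_of_lagrangian ω halt hnd x hx w M N a1 a2 a3 a4 a5 a6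
  refine ⟨M, _, _, ?_, ?_, h⟩
  · obtain ⟨k, hk⟩ := hnil
    refine ⟨k, ?_⟩
    rw [Module.End.pow_restrict]
    ext u; simp [hk]
  · obtain ⟨Φ, _⟩ := h
    rw [Φ.finrank_eq, Module.finrank_prod, Subspace.dual_finrank_eq, two_mul]

theorem hasType_exists [FiniteDimensional K W] (hdim : finrank K W = 2 * n)
    (ω : LinearMap.BilinForm K W) (halt : ω.IsAlt)
    (hnd : ∀ u, (∀ v, ω u v = 0) → u = 0) (x : End K W) (hx : ∀ v, ω (x v) v = 0)
    (hnil : IsNilpotent x) (w : W) : ∃ p : BP n, HasType ω x w p := by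
  obtain ⟨M, y, m, hy, hd, h⟩ := isoH_exists ω halt hnd x hx hnil w
  obtain ⟨p, φ, h1, h2⟩ := enhanced_exists (n := n) (by omega) y hy m
  exact ⟨p, isoH_transport h φ h1 h2⟩

theorem hasType_surj [FiniteDimensional K W] (hdim : finrank K W = 2 * n)
    (ω : LinearMap.BilinForm K W) (halt : ω.IsAlt)
    (hnd : ∀ u, (∀ v, ω u v = 0) → u = 0) (p : BP n) :
    ∃ (x : End K W) (w : W), (∀ v, ω (x v) v = 0) ∧ IsNilpotent x ∧ HasType ω x w p := by
  obtain ⟨M, y, m, hy, hd, Φ₀, hω₀, -, -⟩ := isoH_exists ω halt hnd 0 (by simp) (IsNilpotent.zero) 0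
  set l : Fin n → ℕ := fun i => p.1.1 i + p.1.2 i with hl
  have hfr : finrank K (ModK K l) = finrank K M := by
    rw [Module.finrank_pi_fintype]
    simp only [Module.finrank_fintype_fun_eq_card, Fintype.card_fin, hl, Finset.sum_add_distrib]
    have := p.2.2.2
    omega
  let φ : ModK K l ≃ₗ[K] M := LinearEquiv.ofFinrankEq _ _ hfr
  let Φ : W ≃ₗ[K] ModK K l × Dual K (ModK K l) := Φ₀ ≪≫ₗ φ.symm.prodCongr φ.dualMap
  have hω : ∀ u v, ω u v = (Φ u).2 (Φ v).1 - (Φ v).2 (Φ u).1 := by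
    intro u v
    rw [hω₀]
    simp [Φ]
  let x : End K W := Φ.symm.toLinearMap ∘ₗ ((sh K l).prodMap (sh K l).dualMap) ∘ₗ Φ.toLinearMap
  have hxΦ : ∀ u, Φ (x u) = (sh K l (Φ u).1, (Φ u).2 ∘ₗ sh K l) := by
    intro u
    simp only [x, LinearMap.comp_apply, LinearEquiv.coe_coe, LinearEquiv.apply_symm_apply]
    rfl
  refine ⟨x, Φ.symm (m0 K l p.1.2, 0), ?_, ?_, Φ, hω, hxΦ, by simp; rfl⟩
  · intro v
    rw [hω, hxΦ]; simp
  · refine ⟨n, ?_⟩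
    have hsh : sh K l ^ n = 0 := by
      apply LinearMap.ext
      intro f
      funext i s
      rw [sh_pow_apply, dif_neg]
      · rfl
      · have h1 := s.2
        have h2 : l i ≤ ∑ j, l j := Finset.single_le_sum (fun _ _ => Nat.zero_le _) (Finset.mem_univ i)
        have h3 : ∑ j, l j = n := by
          rw [hl, Finset.sum_add_distrib]; exact p.2.2.2
        omega
    apply LinearMap.ext
    intro u
    apply Φ.injective
    rw [isoH_pow Φ hxΦ, hsh]
    simp

end Types
section Reduction
variable {F V W : Type*} [Field F] [AddCommGroup V] [Module F V] [AddCommGroup W] [Module F W]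

/-- The reduction data from an odd-dimensional quadratic space to its symplectic quotient. -/
structure Red (Q : QuadraticForm F V) (ω : LinearMap.BilinForm F W) (π : V →ₗ[F] W) (σ : W →ₗ[F] V)
    (ρ : V →ₗ[F] F) (r : V) : Prop where
  sec : ∀ w, π (σ w) = w
  dec : ∀ v, v = σ (π v) + ρ v • r
  pr : π r = 0
  pol : ∀ u v, ω (π u) (π v) = QuadraticMap.polar Q u v
  qr : Q r ≠ 0
  nd : ∀ u, (∀ v, ω u v = 0) → u = 0

variable {Q : QuadraticForm F V} {ω : LinearMap.BilinForm F W} {π : V →ₗ[F] W} {σ : W →ₗ[F] V}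
    {ρ : V →ₗ[F] F} {r : V}

namespace Red

theorem r_ne (R : Red Q ω π σ ρ r) : r ≠ 0 := fun h => R.qr (by rw [h, QuadraticMap.map_zero])

theorem exists_of_proj (R : Red Q ω π σ ρ r) {v : V} (h : π v = 0) : v = ρ v • r := by
  have := R.dec v
  rwa [h, map_zero, zero_add] at this

theorem surj (R : Red Q ω π σ ρ r) : Function.Surjective π := fun w => ⟨σ w, R.sec w⟩

theorem alt [CharP F 2] (R : Red Q ω π σ ρ r) : ω.IsAlt := by
  intro w
  obtain ⟨v, rfl⟩ := R.surj w
  rw [R.pol, QuadraticMap.polar_self, two_nsmul, CharTwo.add_self_eq_zero]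

theorem Q_add (R : Red Q ω π σ ρ r) (u v : V) : Q (u + v) = Q u + Q v + ω (π u) (π v) := by
  rw [R.pol, QuadraticMap.polar]; ring

theorem F1 (R : Red Q ω π σ ρ r) {u v : V} (h : π u = π v) (hQ : Q u = Q v) : u = v := by
  have h1 : π (u - v) = 0 := by rw [map_sub, h, sub_self]
  have h2 := R.exists_of_proj h1
  set c := ρ (u - v)
  have h3 : u = v + c • r := by rw [← h2]; abel
  have h4 := R.Q_add v (c • r)
  rw [← h3, hQ, QuadraticMap.map_smul, map_smul, R.pr, smul_zero, map_zero, add_zero, left_eq_add,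
    smul_eq_mul] at h4
  have h5 : c = 0 := by
    rcases mul_eq_zero.1 h4 with h | h
    · exact mul_self_eq_zero.1 h
    · exact absurd h R.qr
  rw [h3, h5, zero_smul, add_zero]

theorem F2 [Finite F] [CharP F 2] (R : Red Q ω π σ ρ r) (w : W) (c : F) : ∃ v, π v = w ∧ Q v = c := by
  obtain ⟨a, ha⟩ := FiniteField.isSquare_of_char_two (ringChar.eq F 2) ((c - Q (σ w)) / Q r)
  refine ⟨σ w + a • r, ?_, ?_⟩
  · rw [map_add, map_smul, R.pr, smul_zero, add_zero, R.sec]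
  · rw [R.Q_add, QuadraticMap.map_smul, map_smul, R.pr, smul_zero, map_zero, add_zero, ← ha, smul_eq_mul,
      div_mul_cancel₀ _ R.qr]; ring

end Red

/-- The orthogonal group. -/
def OGrp (Q : QuadraticForm F V) : Subgroup (V ≃ₗ[F] V) where
  carrier := {g | ∀ v, Q (g v) = Q v}
  mul_mem' := by intro a b ha hb v; exact (ha (b v)).trans (hb v)
  one_mem' := fun _ => rfl
  inv_mem' := by
    intro a ha v
    have := ha (a.symm v)
    rw [LinearEquiv.apply_symm_apply] at this
    exact this.symm

/-- The symplectic group. -/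
def SGrp (ω : LinearMap.BilinForm F W) : Subgroup (W ≃ₗ[F] W) where
  carrier := {g | ∀ u v, ω (g u) (g v) = ω u v}
  mul_mem' := by intro a b ha hb u v; exact (ha (b u) (b v)).trans (hb u v)
  one_mem' := fun _ _ => rfl
  inv_mem' := by
    intro a ha u v
    have := ha (a.symm u) (a.symm v)
    rw [LinearEquiv.apply_symm_apply, LinearEquiv.apply_symm_apply] at this
    exact this.symm

/-- Nilpotent elements of the orthogonal Lie algebra. -/
abbrev NilO (Q : QuadraticForm F V) : Type _ := {x : Module.End F V // Q.mem_oLie x ∧ IsNilpotent x}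

/-- Nilpotent self-adjoint endomorphisms. -/
abbrev NilS (ω : LinearMap.BilinForm F W) : Type _ :=
  {y : Module.End F W // (∀ v, ω (y v) v = 0) ∧ IsNilpotent y}

theorem lconj_pow (g : V ≃ₗ[F] V) (x : End F V) (k : ℕ) : (g.conj x) ^ k = g.conj (x ^ k) := by
  induction k with
  | zero => ext v; simp
  | succ k ih => rw [pow_succ, ih, pow_succ]; ext v; simp

theorem conj_nilp (g : V ≃ₗ[F] V) {x : End F V} (h : IsNilpotent x) : IsNilpotent (g.conj x) := by
  obtain ⟨k, hk⟩ := h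
  exact ⟨k, by rw [lconj_pow, hk, map_zero]⟩

theorem O_polar {g : V ≃ₗ[F] V} (hg : g ∈ OGrp Q) (u v : V) :
    QuadraticMap.polar Q (g u) (g v) = QuadraticMap.polar Q u v := by
  have hg' : ∀ v, Q (g v) = Q v := hg
  simp only [QuadraticMap.polar, ← map_add, hg']

theorem conj_NilO {g : V ≃ₗ[F] V} (hg : g ∈ OGrp Q) {x : End F V} (hx : Q.mem_oLie x ∧ IsNilpotent x) :
    Q.mem_oLie (g.conj x) ∧ IsNilpotent (g.conj x) := by
  refine ⟨⟨fun v => ?_, ?_⟩, conj_nilp g hx.2⟩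
  · obtain ⟨u, rfl⟩ := g.surjective v
    have : g.conj x (g u) = g (x u) := by simp [LinearEquiv.conj_apply]
    rw [this, O_polar hg]
    exact hx.1.1 u
  · rw [LinearMap.trace_conj']; exact hx.1.2

theorem conj_NilS {g : W ≃ₗ[F] W} (hg : g ∈ SGrp ω) {x : End F W} (hx : (∀ v, ω (x v) v = 0) ∧ IsNilpotent x) :
    (∀ v, ω (g.conj x v) v = 0) ∧ IsNilpotent (g.conj x) := by
  refine ⟨fun v => ?_, conj_nilp g hx.2⟩
  obtain ⟨u, rfl⟩ := g.surjective v
  have : g.conj x (g u) = g (x u) := by simp [LinearEquiv.conj_apply]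
  have hg' : ∀ u v, ω (g u) (g v) = ω u v := hg
  rw [this, hg']
  exact hx.1 u

/-- The conjugation action of the orthogonal group. -/
instance actO (Q : QuadraticForm F V) : MulAction (OGrp Q) (NilO Q) where
  smul g x := ⟨g.1.conj x.1, conj_NilO g.2 x.2⟩
  one_smul x := Subtype.ext (by apply LinearMap.ext; intro v; rfl)
  mul_smul a b x := Subtype.ext (by apply LinearMap.ext; intro v; rfl)

/-- The diagonal action of the symplectic group. -/
instance actS (ω : LinearMap.BilinForm F W) : MulAction (SGrp ω) (NilS ω × W) where
  smul g x := (⟨g.1.conj x.1.1, conj_NilS g.2 x.1.2⟩, g.1 x.2)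
  one_smul x := Prod.ext (Subtype.ext (by apply LinearMap.ext; intro v; rfl)) rfl
  mul_smul a b x := Prod.ext (Subtype.ext (by apply LinearMap.ext; intro v; rfl)) rfl

theorem conj_eq_iff (g : V ≃ₗ[F] V) (x y : End F V) : g.conj x = y ↔ ∀ v, g (x v) = y (g v) := by
  constructor
  · rintro rfl v; simp [LinearEquiv.conj_apply]
  · intro h
    apply LinearMap.ext
    intro v
    obtain ⟨u, rfl⟩ := g.surjective v
    simp [LinearEquiv.conj_apply, h]

theorem smulO_iff (g : OGrp Q) (x y : NilO Q) : g • x = y ↔ ∀ v, g.1 (x.1 v) = y.1 (g.1 v) := by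
  rw [← conj_eq_iff]
  exact Subtype.ext_iff

theorem smulS_iff (g : SGrp ω) (x y : NilS ω × W) :
    g • x = y ↔ (∀ v, g.1 (x.1.1 v) = y.1.1 (g.1 v)) ∧ g.1 x.2 = y.2 := by
  rw [← conj_eq_iff, Prod.ext_iff]
  exact and_congr Subtype.ext_iff Iff.rfl

namespace Red

theorem g_fix (R : Red Q ω π σ ρ r) (g : OGrp Q) : g.1 r = r := by
  apply R.F1
  · rw [R.pr]
    apply R.nd
    intro w
    obtain ⟨v, rfl⟩ := R.surj w
    obtain ⟨u, rfl⟩ := g.1.surjective v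
    rw [R.pol, O_polar g.2, ← R.pol, R.pr, map_zero, LinearMap.zero_apply]
  · exact g.2 r

theorem exists_s [FiniteDimensional F W] (R : Red Q ω π σ ρ r) (g : OGrp Q) :
    ∃ s : SGrp ω, ∀ v, s.1 (π v) = π (g.1 v) := by
  let s0 : W →ₗ[F] W := π ∘ₗ g.1.toLinearMap ∘ₗ σ
  have h0 : ∀ v, s0 (π v) = π (g.1 v) := by
    intro v
    conv_rhs => rw [R.dec v, map_add, map_smul, R.g_fix, map_add, map_smul, R.pr, smul_zero, add_zero]
    rfl
  have h1 : ∀ u v, ω (s0 u) (s0 v) = ω u v := by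
    intro u v
    obtain ⟨u, rfl⟩ := R.surj u
    obtain ⟨v, rfl⟩ := R.surj v
    rw [h0, h0, R.pol, R.pol, O_polar g.2]
  have inj : Function.Injective s0 := by
    rw [injective_iff_map_eq_zero]
    intro u hu
    apply R.nd
    intro v
    rw [← h1, hu, map_zero, LinearMap.zero_apply]
  exact ⟨⟨LinearEquiv.ofInjectiveEndo s0 inj, h1⟩, h0⟩

theorem exists_g [Finite F] [CharP F 2] [FiniteDimensional F V] (R : Red Q ω π σ ρ r) (s : SGrp ω) :
    ∃ g : OGrp Q, ∀ v, s.1 (π v) = π (g.1 v) := by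
  have hs : ∀ u v, ω (s.1 u) (s.1 v) = ω u v := s.2
  choose f hf1 hf2 using fun v => R.F2 (s.1 (π v)) (Q v)
  let g0 : V →ₗ[F] V :=
    { toFun := f
      map_add' := by
        intro u v
        apply R.F1
        · simp only [hf1, map_add]
        · simp only [hf1, hf2, R.Q_add, hs]
      map_smul' := by
        intro c v
        apply R.F1
        · simp only [hf1, map_smul, RingHom.id_apply]
        · simp only [hf2, QuadraticMap.map_smul, RingHom.id_apply] }
  have inj : Function.Injective g0 := by
    rw [injective_iff_map_eq_zero]
    intro u hu
    have hu' : f u = 0 := hu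
    apply R.F1
    · apply s.1.injective
      rw [← hf1, hu', map_zero, map_zero]
    · rw [← hf2, hu']
  exact ⟨⟨LinearEquiv.ofInjectiveEndo g0 inj, hf2⟩, fun v => (hf1 v).symm⟩

theorem exists_equiv [Finite F] [CharP F 2] [FiniteDimensional F V] [FiniteDimensional F W]
    (R : Red Q ω π σ ρ r) :
    ∃ γ : OGrp Q ≃ SGrp ω, ∀ g v, (γ g).1 (π v) = π (g.1 v) := by
  choose f hf using R.exists_s
  refine ⟨Equiv.ofBijective f ⟨?_, ?_⟩, hf⟩
  · intro g g' h
    apply Subtype.ext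
    apply LinearEquiv.ext
    intro v
    apply R.F1
    · rw [← hf, ← hf, h]
    · exact (g.2 v).trans (g'.2 v).symm
  · intro s
    obtain ⟨g, hg⟩ := R.exists_g s
    refine ⟨g, ?_⟩
    apply Subtype.ext
    apply LinearEquiv.ext
    intro w
    obtain ⟨v, rfl⟩ := R.surj w
    rw [hf, hg]

theorem x_r [CharP F 2] (R : Red Q ω π σ ρ r) (x : NilO Q) : x.1 r = 0 := by
  have h0 : π (x.1 r) = 0 := by
    apply R.nd
    intro w
    obtain ⟨v, rfl⟩ := R.surj w
    rw [R.pol]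
    have h1 := x.2.1.1 (r + v)
    have e1 := x.2.1.1 r
    have e2 := x.2.1.1 v
    rw [← R.pol] at h1 e1 e2 ⊢
    rw [R.pr] at e1
    simp only [map_add, R.pr, zero_add, LinearMap.add_apply, e2, add_zero] at h1
    exact h1
  have h1 := R.exists_of_proj h0
  set c := ρ (x.1 r)
  obtain ⟨k, hk⟩ := x.2.2
  have h2 : ∀ k, (x.1 ^ k) r = c ^ k • r := by
    intro k
    induction k with
    | zero => simp
    | succ k ih => rw [pow_succ, Module.End.mul_apply, h1, map_smul, ih, smul_smul, pow_succ, mul_comm]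
  have h3 := h2 k
  rw [hk, LinearMap.zero_apply] at h3
  rcases smul_eq_zero.1 h3.symm with h | h
  · rw [h1, eq_zero_of_pow_eq_zero h, zero_smul]
  · exact absurd h R.r_ne

/-- The element of the Lie algebra attached to `(y, h)`. -/
def xh (_R : Red Q ω π σ ρ r) (y : End F W) (h : Dual F W) : End F V :=
  σ ∘ₗ y ∘ₗ π + (h ∘ₗ π).smulRight r

theorem xh_apply (R : Red Q ω π σ ρ r) (y : End F W) (h : Dual F W) (v : V) :
    R.xh y h v = σ (y (π v)) + h (π v) • r := rfl

theorem pi_xh (R : Red Q ω π σ ρ r) (y : End F W) (h : Dual F W) (v : V) :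
    π (R.xh y h v) = y (π v) := by
  rw [xh_apply, map_add, map_smul, R.pr, smul_zero, add_zero, R.sec]

theorem xh_mem [FiniteDimensional F V] (R : Red Q ω π σ ρ r) (y : NilS ω) (h : Dual F W) :
    Q.mem_oLie (R.xh y.1 h) ∧ IsNilpotent (R.xh y.1 h) := by
  have hn : IsNilpotent (R.xh y.1 h) := by
    obtain ⟨k, hk⟩ := y.2.2
    have h1 : ∀ k v, π ((R.xh y.1 h ^ k) v) = (y.1 ^ k) (π v) := by
      intro k
      induction k with
      | zero => intro v; rfl
      | succ k ih =>
        intro v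
        rw [pow_succ, pow_succ, Module.End.mul_apply, Module.End.mul_apply, ih, pi_xh]
    refine ⟨k + 1, ?_⟩
    apply LinearMap.ext
    intro v
    rw [pow_succ', Module.End.mul_apply, xh_apply, h1, hk]
    simp
  refine ⟨⟨fun v => ?_, ?_⟩, hn⟩
  · rw [← R.pol, pi_xh]; exact y.2.1 _
  · exact (LinearMap.isNilpotent_trace_of_isNilpotent hn).eq_zero

theorem xh_inj (R : Red Q ω π σ ρ r) {y y' : End F W} {h h' : Dual F W} (e : R.xh y h = R.xh y' h') :
    y = y' ∧ h = h' := by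
  have h1 : y = y' := by
    apply LinearMap.ext
    intro w
    obtain ⟨v, rfl⟩ := R.surj w
    rw [← R.pi_xh y h, ← R.pi_xh y' h', e]
  refine ⟨h1, ?_⟩
  apply LinearMap.ext
  intro w
  obtain ⟨v, rfl⟩ := R.surj w
  have := LinearMap.congr_fun e v
  rw [xh_apply, xh_apply, h1] at this
  exact smul_left_injective F R.r_ne (add_left_cancel this)

theorem xh_surj [CharP F 2] (R : Red Q ω π σ ρ r) (x : NilO Q) :
    ∃ (y : NilS ω) (h : Dual F W), x.1 = R.xh y.1 h := by
  let y : End F W := π ∘ₗ x.1 ∘ₗ σ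
  have hxs : ∀ v, x.1 v = x.1 (σ (π v)) := by
    intro v
    conv_lhs => rw [R.dec v, map_add, map_smul, R.x_r, smul_zero, add_zero]
  have hy : ∀ v, y (π v) = π (x.1 v) := by
    intro v
    rw [hxs v]; rfl
  have hyp : ∀ k v, (y ^ k) (π v) = π ((x.1 ^ k) v) := by
    intro k
    induction k with
    | zero => intro v; rfl
    | succ k ih =>
      intro v
      rw [pow_succ, pow_succ, Module.End.mul_apply, Module.End.mul_apply, hy, ih]
  refine ⟨⟨y, ?_, ?_⟩, ρ ∘ₗ x.1 ∘ₗ σ, ?_⟩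
  · intro w
    obtain ⟨v, rfl⟩ := R.surj w
    rw [hy, R.pol]
    exact x.2.1.1 v
  · obtain ⟨k, hk⟩ := x.2.2
    refine ⟨k, ?_⟩
    apply LinearMap.ext
    intro w
    obtain ⟨v, rfl⟩ := R.surj w
    rw [hyp, hk]; simp
  · apply LinearMap.ext
    intro v
    rw [xh_apply, hy]
    conv_lhs => rw [R.dec (x.1 v)]
    rw [LinearMap.comp_apply, LinearMap.comp_apply, ← hxs]

/-- The obstruction functional. -/
def del (_R : Red Q ω π σ ρ r) (g : OGrp Q) (s : SGrp ω) (y : End F W) : Dual F W :=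
  ρ ∘ₗ (g.1.toLinearMap ∘ₗ σ ∘ₗ y - σ ∘ₗ y ∘ₗ s.1.toLinearMap)

theorem fix_iff (R : Red Q ω π σ ρ r) (g : OGrp Q) (s : SGrp ω) (hgs : ∀ v, s.1 (π v) = π (g.1 v))
    (y : End F W) (h : Dual F W) :
    (∀ v, g.1 (R.xh y h v) = R.xh y h (g.1 v)) ↔
      (∀ w, s.1 (y w) = y (s.1 w)) ∧ (s.1.toLinearMap - LinearMap.id).dualMap h = R.del g s y := by
  have hdel : (∀ w, s.1 (y w) = y (s.1 w)) → ∀ w,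
      g.1 (σ (y w)) = σ (y (s.1 w)) + R.del g s y w • r := by
    intro hc w
    have := R.exists_of_proj (v := g.1 (σ (y w)) - σ (y (s.1 w))) (by
      rw [map_sub, ← hgs, R.sec, R.sec, hc, sub_self])
    have e : R.del g s y w = ρ (g.1 (σ (y w)) - σ (y (s.1 w))) := rfl
    rw [e, ← this]; abel
  have key : (∀ w, s.1 (y w) = y (s.1 w)) → ∀ v, (g.1 (R.xh y h v) = R.xh y h (g.1 v) ↔
      (s.1.toLinearMap - LinearMap.id).dualMap h (π v) = R.del g s y (π v)) := by
    intro hc v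
    rw [xh_apply, xh_apply, map_add, map_smul, R.g_fix, hdel hc, ← hgs, add_assoc, add_right_inj, ← add_smul,
      (smul_left_injective F R.r_ne).eq_iff, LinearMap.dualMap_apply, LinearMap.sub_apply, map_sub,
      eq_comm, sub_eq_iff_eq_add]
    rfl
  constructor
  · intro hx
    have hc : ∀ w, s.1 (y w) = y (s.1 w) := by
      intro w
      obtain ⟨v, rfl⟩ := R.surj w
      have := congrArg π (hx v)
      rw [← hgs, pi_xh, pi_xh, ← hgs] at this
      exact this
    refine ⟨hc, ?_⟩
    apply LinearMap.ext
    intro w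
    obtain ⟨v, rfl⟩ := R.surj w
    exact (key hc v).1 (hx v)
  · rintro ⟨hc, h2⟩ v
    exact (key hc v).2 (LinearMap.congr_fun h2 _)

theorem del_range [FiniteDimensional F W] (R : Red Q ω π σ ρ r) (g : OGrp Q) (s : SGrp ω)
    (hgs : ∀ v, s.1 (π v) = π (g.1 v))
    (y : End F W) (hc : ∀ w, s.1 (y w) = y (s.1 w)) :
    ∃ h, (s.1.toLinearMap - LinearMap.id).dualMap h = R.del g s y := by
  have : R.del g s y ∈ LinearMap.range (s.1.toLinearMap - LinearMap.id).dualMap := by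
    rw [LinearMap.range_dualMap_eq_dualAnnihilator_ker, Submodule.mem_dualAnnihilator]
    intro w hw
    have hw' : s.1 w = w := by
      have := LinearMap.mem_ker.1 hw
      rw [LinearMap.sub_apply, sub_eq_zero] at this
      exact this
    have e : R.del g s y w = ρ (g.1 (σ (y w)) - σ (y (s.1 w))) := rfl
    have e2 : g.1 (σ (y w)) = σ (y (s.1 w)) := by
      rw [hw']
      apply R.F1
      · rw [← hgs, R.sec, hc, hw']
      · exact g.2 _
    rw [e, e2, sub_self, map_zero]
  exact this

theorem sub_equiv {U U' : Type*} [AddCommGroup U] [Module F U] [AddCommGroup U'] [Module F U']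
    [FiniteDimensional F U] [FiniteDimensional F U'] (A : Submodule F U) (B : Submodule F U')
    (h : finrank F A = finrank F B) : Nonempty (A ≃ B) :=
  ⟨(LinearEquiv.ofFinrankEq A B h).toEquiv⟩

theorem card_fixed [CharP F 2] [FiniteDimensional F V] [FiniteDimensional F W] (R : Red Q ω π σ ρ r)
    (g : OGrp Q) (s : SGrp ω) (hgs : ∀ v, s.1 (π v) = π (g.1 v)) :
    Nat.card (MulAction.fixedBy (NilO Q) g) = Nat.card (MulAction.fixedBy (NilS ω × W) s) := by
  set T : W →ₗ[F] W := s.1.toLinearMap - LinearMap.id with hT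
  have hfr : finrank F (LinearMap.ker T) = finrank F (LinearMap.ker T.dualMap) := by
    have h1 := LinearMap.finrank_range_add_finrank_ker T
    have h2 := LinearMap.finrank_range_add_finrank_ker T.dualMap
    rw [LinearMap.finrank_range_dualMap_eq_finrank_range, Subspace.dual_finrank_eq] at h2
    omega
  obtain ⟨e⟩ := sub_equiv (LinearMap.ker T) (LinearMap.ker T.dualMap) hfr
  choose h0 hh0 using fun y : {y : NilS ω // ∀ w, s.1 (y.1 w) = y.1 (s.1 w)} =>
    R.del_range g s hgs y.1.1 y.2
  let f : {y : NilS ω // ∀ w, s.1 (y.1 w) = y.1 (s.1 w)} × LinearMap.ker T.dualMap →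
      MulAction.fixedBy (NilO Q) g := fun p =>
    ⟨⟨R.xh p.1.1.1 (h0 p.1 + p.2.1), R.xh_mem _ _⟩, by
      rw [MulAction.mem_fixedBy, smulO_iff]
      refine (R.fix_iff g s hgs _ _).2 ⟨p.1.2, ?_⟩
      have := LinearMap.mem_ker.1 p.2.2
      rw [map_add, hh0, ← hT, this, add_zero]⟩
  have hf : Function.Bijective f := by
    constructor
    · rintro ⟨y, h⟩ ⟨y', h'⟩ hyh
      have h1 : R.xh y.1.1 (h0 y + h.1) = R.xh y'.1.1 (h0 y' + h'.1) :=
        congrArg (fun z => z.1.1) hyh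
      obtain ⟨h2, h3⟩ := R.xh_inj h1
      have h4 : y = y' := Subtype.ext (Subtype.ext h2)
      subst h4
      exact Prod.ext rfl (Subtype.ext (add_left_cancel h3))
    · rintro ⟨x, hx⟩
      rw [MulAction.mem_fixedBy, smulO_iff] at hx
      obtain ⟨y, h, hxy⟩ := R.xh_surj x
      rw [hxy] at hx
      obtain ⟨hc, hd⟩ := (R.fix_iff g s hgs _ _).1 hx
      refine ⟨(⟨y, hc⟩, ⟨h - h0 ⟨y, hc⟩, ?_⟩), ?_⟩
      · rw [LinearMap.mem_ker, map_sub, hh0, hT, hd, sub_self]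
      · apply Subtype.ext
        apply Subtype.ext
        simp only [f, hxy, add_sub_cancel]
  let f' : {y : NilS ω // ∀ w, s.1 (y.1 w) = y.1 (s.1 w)} × LinearMap.ker T →
      MulAction.fixedBy (NilS ω × W) s := fun p =>
    ⟨(p.1.1, p.2.1), by
      rw [MulAction.mem_fixedBy, smulS_iff]
      refine ⟨p.1.2, ?_⟩
      have := LinearMap.mem_ker.1 p.2.2
      rw [LinearMap.sub_apply, sub_eq_zero] at this
      exact this⟩
  have hf' : Function.Bijective f' := by
    constructor
    · rintro ⟨y, h⟩ ⟨y', h'⟩ hyh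
      have h1 : (y.1, h.1) = (y'.1, h'.1) := congrArg (fun z => z.1) hyh
      exact Prod.ext (Subtype.ext (congrArg Prod.fst h1)) (Subtype.ext (congrArg Prod.snd h1))
    · rintro ⟨⟨y, w⟩, hx⟩
      have hx' := hx
      rw [MulAction.mem_fixedBy, smulS_iff] at hx'
      refine ⟨(⟨y, hx'.1⟩, ⟨w, ?_⟩), rfl⟩
      rw [LinearMap.mem_ker, LinearMap.sub_apply, sub_eq_zero]
      exact hx'.2
  rw [← Nat.card_eq_of_bijective f hf, ← Nat.card_eq_of_bijective f' hf']
  exact Nat.card_congr ((Equiv.refl _).prodCongr e.symm)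

theorem orbits_eq [Finite F] [CharP F 2] [FiniteDimensional F V] [FiniteDimensional F W]
    (R : Red Q ω π σ ρ r) :
    Nat.card (Quotient (MulAction.orbitRel (OGrp Q) (NilO Q))) =
      Nat.card (Quotient (MulAction.orbitRel (SGrp ω) (NilS ω × W))) := by
  classical
  obtain ⟨γ, hγ⟩ := R.exists_equiv
  have : Finite V := Module.finite_of_finite F
  have : Finite W := Module.finite_of_finite F
  have : Finite (End F V) := Module.finite_of_finite F
  have : Finite (End F W) := Module.finite_of_finite F
  have : Finite (V ≃ₗ[F] V) := Finite.of_injective _ LinearEquiv.toLinearMap_injective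
  have : Finite (W ≃ₗ[F] W) := Finite.of_injective _ LinearEquiv.toLinearMap_injective
  let _ := Fintype.ofFinite (OGrp Q)
  let _ := Fintype.ofFinite (SGrp ω)
  let _ := Fintype.ofFinite (Quotient (MulAction.orbitRel (OGrp Q) (NilO Q)))
  let _ := Fintype.ofFinite (Quotient (MulAction.orbitRel (SGrp ω) (NilS ω × W)))
  let _ := fun g : OGrp Q => Fintype.ofFinite (MulAction.fixedBy (NilO Q) g)
  let _ := fun g : SGrp ω => Fintype.ofFinite (MulAction.fixedBy (NilS ω × W) g)
  have b1 := MulAction.sum_card_fixedBy_eq_card_orbits_mul_card_group (OGrp Q) (NilO Q)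
  have b2 := MulAction.sum_card_fixedBy_eq_card_orbits_mul_card_group (SGrp ω) (NilS ω × W)
  have hs : ∑ g : OGrp Q, Fintype.card (MulAction.fixedBy (NilO Q) g) =
      ∑ s : SGrp ω, Fintype.card (MulAction.fixedBy (NilS ω × W) s) := by
    refine Fintype.sum_equiv γ _ _ fun g => ?_
    rw [← Nat.card_eq_fintype_card, ← Nat.card_eq_fintype_card]
    exact R.card_fixed g (γ g) (hγ g)
  rw [hs, b2, Fintype.card_congr γ] at b1
  rw [Nat.card_eq_fintype_card, Nat.card_eq_fintype_card]
  exact (Nat.eq_of_mul_eq_mul_right Fintype.card_pos b1).symm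

end Red

theorem orbits_symp [FiniteDimensional F W] {n : ℕ} (hdim : finrank F W = 2 * n) (halt : ω.IsAlt)
    (hnd : ∀ u, (∀ v, ω u v = 0) → u = 0) :
    Nat.card (Quotient (MulAction.orbitRel (SGrp ω) (NilS ω × W))) = Nat.card (BP n) := by
  choose t ht using fun z : NilS ω × W =>
    hasType_exists (n := n) hdim ω halt hnd z.1.1 z.1.2.1 z.1.2.2 z.2
  have hrel : ∀ a b : NilS ω × W, (MulAction.orbitRel (SGrp ω) (NilS ω × W)) a b ↔ t a = t b := by
    intro a b
    rw [MulAction.orbitRel_apply, MulAction.mem_orbit_iff]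
    constructor
    · rintro ⟨g, hg⟩
      obtain ⟨h1, h2⟩ := (smulS_iff _ _ _).1 hg
      have := isoH_of_conj (ht a) g.1 g.2 h1 h2
      exact (hasType_unique (ht b) this).symm
    · intro h
      have hb := ht b
      rw [← h] at hb
      obtain ⟨g, h1, h2, h3⟩ := isoH_conj hb (ht a)
      exact ⟨⟨g, h1⟩, (smulS_iff _ _ _).2 ⟨h2, h3⟩⟩
  refine Nat.card_eq_of_bijective (Quotient.lift t fun a b h => (hrel a b).1 h) ⟨?_, ?_⟩
  · intro a b
    induction a using Quotient.inductionOn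
    induction b using Quotient.inductionOn
    intro h
    exact Quotient.sound ((hrel _ _).2 h)
  · intro p
    obtain ⟨x, w, h1, h2, h3⟩ := hasType_surj hdim ω halt hnd p
    refine ⟨Quotient.mk _ (⟨x, h1, h2⟩, w), ?_⟩
    exact hasType_unique (ht (⟨x, h1, h2⟩, w)) h3

theorem quot_orbits (Q : QuadraticForm F V) :
    Q.numNilpotentOOrbits = Nat.card (Quotient (MulAction.orbitRel (OGrp Q) (NilO Q))) := by
  unfold QuadraticForm.numNilpotentOOrbits
  refine Nat.card_congr (Quot.congrRight fun x y => ?_)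
  rw [(MulAction.orbitRel (OGrp Q) (NilO Q)).comm', MulAction.orbitRel_apply, MulAction.mem_orbit_iff]
  constructor
  · rintro ⟨g, hg, h⟩
    exact ⟨⟨g, hg⟩, Subtype.ext h.symm⟩
  · rintro ⟨g, h⟩
    exact ⟨g.1, g.2, (congrArg Subtype.val h).symm⟩

theorem exists_red [CharP F 2] [FiniteDimensional F V] {n : ℕ} (Q : QuadraticForm F V)
    (hdim : Module.finrank F V = 2 * n + 1) (hQ : Q.IsNondegenerateFormSpace) :
    ∃ (r : V) (ω : LinearMap.BilinForm F (V ⧸ (F ∙ r))) (σ : (V ⧸ (F ∙ r)) →ₗ[F] V) (ρ : V →ₗ[F] F),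
      Red Q ω (F ∙ r).mkQ σ ρ r ∧ finrank F (V ⧸ (F ∙ r)) = 2 * n := by
  obtain ⟨-, h1, h2⟩ := hQ
  have hself : ∀ v, QuadraticMap.polarBilin Q v v = 0 := by
    intro v
    rw [QuadraticMap.polarBilin_apply_apply, QuadraticMap.polar_self, two_nsmul, CharTwo.add_self_eq_zero]
  have hne : Q.polarRadical ≠ ⊥ := by
    intro hbot
    obtain ⟨M, y, m, hy, hd, -⟩ := isoH_exists (QuadraticMap.polarBilin Q) hself (by
      intro u hu
      have : u ∈ Q.polarRadical := LinearMap.mem_ker.2 (LinearMap.ext hu)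
      rw [hbot] at this
      exact (Submodule.mem_bot F).1 this) 0 (by simp) IsNilpotent.zero 0
    omega
  obtain ⟨r, hr, hr0⟩ := (Submodule.ne_bot_iff _).1 hne
  have hspan : Q.polarRadical = F ∙ r := by
    symm
    apply Submodule.eq_of_le_of_finrank_le
    · rw [Submodule.span_singleton_le_iff_mem]; exact hr
    · rw [finrank_span_singleton hr0]; exact h1
  have hfr : finrank F (V ⧸ (F ∙ r)) = 2 * n := by
    have := Submodule.finrank_quotient_add_finrank (F ∙ r)
    rw [finrank_span_singleton hr0] at this
    omega
  have hsymm : ∀ u v, QuadraticMap.polarBilin Q u v = QuadraticMap.polarBilin Q v u := fun u v =>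
    QuadraticMap.polar_comm Q u v
  have hker : ∀ u ∈ F ∙ r, QuadraticMap.polarBilin Q u = 0 := by
    intro u hu; rw [← hspan] at hu; exact hu
  let ω₁ : (V ⧸ (F ∙ r)) →ₗ[F] V →ₗ[F] F := (F ∙ r).liftQ (QuadraticMap.polarBilin Q) hker
  let ω : LinearMap.BilinForm F (V ⧸ (F ∙ r)) := ((F ∙ r).liftQ ω₁.flip (by
    intro u hu
    rw [LinearMap.mem_ker]
    apply LinearMap.ext
    intro w
    obtain ⟨v, rfl⟩ := (F ∙ r).mkQ_surjective w
    change QuadraticMap.polarBilin Q v u = 0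
    rw [hsymm, hker u hu]; rfl)).flip
  have hω : ∀ u v, ω ((F ∙ r).mkQ u) ((F ∙ r).mkQ v) = QuadraticMap.polar Q u v := fun _ _ => rfl
  obtain ⟨σ, hσ⟩ := (F ∙ r).mkQ.exists_rightInverse_of_surjective (Submodule.range_mkQ _)
  have hσ' : ∀ w, (F ∙ r).mkQ (σ w) = w := fun w => LinearMap.congr_fun hσ w
  obtain ⟨f, hf⟩ := Module.Projective.exists_dual_eq_one F hr0
  refine ⟨r, ω, σ, f ∘ₗ (LinearMap.id - σ ∘ₗ (F ∙ r).mkQ), ⟨hσ', ?_, ?_, hω, h2 r hr hr0, ?_⟩, hfr⟩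
  · intro v
    have h3 : v - σ ((F ∙ r).mkQ v) ∈ F ∙ r := by
      have h4 : v - σ ((F ∙ r).mkQ v) ∈ LinearMap.ker (F ∙ r).mkQ := by
        rw [LinearMap.mem_ker, map_sub, hσ', sub_self]
      rwa [(F ∙ r).ker_mkQ] at h4
    obtain ⟨c, hc⟩ := Submodule.mem_span_singleton.1 h3
    rw [LinearMap.comp_apply, LinearMap.sub_apply, LinearMap.comp_apply, LinearMap.id_apply, ← hc,
      map_smul, hf, smul_eq_mul, mul_one, hc]
    abel
  · rw [← LinearMap.mem_ker, (F ∙ r).ker_mkQ]; exact Submodule.mem_span_singleton_self r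
  · intro w hw
    obtain ⟨u, rfl⟩ := (F ∙ r).mkQ_surjective w
    rw [← LinearMap.mem_ker, (F ∙ r).ker_mkQ, ← hspan]
    apply LinearMap.mem_ker.2
    apply LinearMap.ext
    intro v
    exact hw ((F ∙ r).mkQ v)

end Reduction

/-- Over a finite field `F` of characteristic 2 (i.e. of order a power of 2), the number of
nilpotent `O_{2n+1}(F)`-orbits in `𝔬_{2n+1}(F)` is `p₂(n)`. -/
theorem nilpotent_orbits_odd_orthogonal
    (F : Type*) [Field F] [Fintype F] [CharP F 2]
    (n : ℕ) (hn : 1 ≤ n)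
    (V : Type*) [AddCommGroup V] [Module F V] [FiniteDimensional F V]
    (Q : QuadraticForm F V)
    (hdim : Module.finrank F V = 2 * n + 1)
    (hQ : Q.IsNondegenerateFormSpace) :
    Q.numNilpotentOOrbits = numPartitionPairs n := by
  obtain ⟨r, ω, σ, ρ, R, hfr⟩ := exists_red Q hdim hQ
  rw [quot_orbits, R.orbits_eq, orbits_symp hfr R.alt R.nd, card_BP]
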